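/- Let d ≥ 1 and let 1 ≤ p₀, p₁, p₂, q₁, q₂, q₃, r₀, r₁, r₂, s₁, s₂, s₃ ≤ ∞ satisfy: 1/p₁ + 1/r₁ ≥ 1; 1/p₂ + 1/r₂ ≥ 1; r₂ ≤ p₀; r₁ ≤ r₀; r₂ ≤ r₀; 2 + 1/p₀ ≤ 1/r₀ + 1/r₁ + 1/r₂ + 1/max{p₁, r₀′} + 1/p₂; and on the frequency side: s₃ ≤ q₂′; s₃ ≤ s₂; 2 ≤ 1/max{q₁,s₁′} + 1/max{q₂,s₂′} + 1/s₂ + 1/s₃; 2 + 1/q₃ ≤ 1/max{q₁,s₁′} + 1/max{q₂,s₂′} + 1/s₁ + 1/s₂ + 1/s₃ (where a′ denotes the conjugate exponent). Then there is a constant C > 0 such that for every bounded measurable σ : ℝ^{3d} → ℂ with ‖σ‖_{𝓜^{(r₀,r₁,r₂);(s₁,s₂,s₃)}} < ∞ and all Schwartz f₁, f₂ on ℝ^d: ‖T_σ(f₁,f₂)‖_{M^{p₀,q₃}} ≤ C · ‖σ‖_{𝓜^{(r₀,r₁,r₂);(s₁,s₂,s₃)}} · ‖f₁‖_{M^{p₁,q₁}}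 · ‖f₂‖_{M^{p₂,q₂}}. -/

import Mathlib

open MeasureTheory Complex
open scoped ENNReal NNReal RealInnerProductSpace

noncomputable section

abbrev Ed (d : ℕ) := EuclideanSpace ℝ (Fin d)

/-- `e2pi a = e^{2πi a}`. -/
def e2pi (a : ℝ) : ℂ := Complex.exp (2 * Real.pi * Complex.I * (a : ℂ))

/-- Short-time Fourier transform `V_φ f (t, ν)`. -/
def STFT (d : ℕ) (φ f : Ed d → ℂ) (t ν : Ed d) : ℂ :=
  ∫ y, f y * e2pi (-⟪y, ν⟫) * φ (y - t)

/-- The Gaussian window `e^{-‖x‖²}` as a complex-valued function. -/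
def gauss (d : ℕ) : Ed d → ℂ := fun x => (Real.exp (-‖x‖ ^ 2) : ℝ)

/-- `L^p`-type norm (`ℝ≥0∞`-valued) with essential supremum in case `p = ∞`. -/
def eNorm {α : Type*} [MeasurableSpace α] (μ : Measure α) (p : ℝ≥0∞) (F : α → ℝ≥0∞) : ℝ≥0∞ :=
  if p = ∞ then essSup F μ else (∫⁻ a, F a ^ p.toReal ∂μ) ^ (1 / p.toReal)

/-- Modulation space norm `‖f‖_{M^{p,q}}` with the Gaussian window. -/
def modNorm (d : ℕ) (p q : ℝ≥0∞) (f : Ed d → ℂ) : ℝ≥0∞ :=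
  eNorm volume q fun ν => eNorm volume p fun t => (‖STFT d (gauss d) f t ν‖₊ : ℝ≥0∞)

/-- The Gaussian window on `ℝ^{3d}`. -/
def gauss3 (d : ℕ) : Ed d × Ed d × Ed d → ℂ :=
  fun X => (Real.exp (-‖X.1‖ ^ 2 - ‖X.2.1‖ ^ 2 - ‖X.2.2‖ ^ 2) : ℝ)

/-- Symbol short-time Fourier transform of a symbol on `ℝ^{3d}`. -/
def symbSTFT (d : ℕ) (Φ σ : Ed d × Ed d × Ed d → ℂ) (x t₁ t₂ ξ₁ ξ₂ ν : Ed d) : ℂ :=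
  ∫ X : Ed d × Ed d × Ed d,
    σ X * Φ (X.1 - x, X.2.1 - ξ₁, X.2.2 - ξ₂) *
      e2pi (-(⟪X.1, ν⟫ - ⟪t₁, X.2.1⟫ - ⟪t₂, X.2.2⟫))

/-- Fourier transform. -/
def FT (d : ℕ) (f : Ed d → ℂ) (ξ : Ed d) : ℂ := ∫ y, f y * e2pi (-⟪y, ξ⟫)

/-- Bilinear pseudodifferential operator `T_σ`. -/
def biOp (d : ℕ) (σ : Ed d × Ed d × Ed d → ℂ) (f₁ f₂ : Ed d → ℂ) (x : Ed d) : ℂ :=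
  ∫ ξ : Ed d × Ed d,
    e2pi ⟪x, ξ.1 + ξ.2⟫ * σ (x, ξ.1, ξ.2) * FT d f₁ ξ.1 * FT d f₂ ξ.2


/-- The symbol-modulation norm `‖σ‖_{𝓜^{(r₀,r₁,r₂);(s₁,s₂,s₃)}}`: iterated mixed norm of
`𝒱_Φ σ`, integrating `x` with exponent `r₀` (innermost), then `t₁, t₂` with `r₁, r₂`,
then `ξ₁, ξ₂` with `s₁, s₂`, and `ν` with `s₃` (outermost); essential suprema for `∞`. -/
def symbNorm (d : ℕ) (r₀ r₁ r₂ s₁ s₂ s₃ : ℝ≥0∞) (σ : Ed d × Ed d × Ed d → ℂ) : ℝ≥0∞ :=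
  eNorm volume s₃ (fun ν => eNorm volume s₂ (fun ξ₂ => eNorm volume s₁ (fun ξ₁ =>
    eNorm volume r₂ (fun t₂ => eNorm volume r₁ (fun t₁ => eNorm volume r₀ (fun x =>
      (‖symbSTFT d (gauss3 d) σ x t₁ t₂ ξ₁ ξ₂ ν‖₊ : ℝ≥0∞)))))))

section LpTheory

variable {α β γ : Type*} [MeasurableSpace α] [MeasurableSpace β] [MeasurableSpace γ]

/-- The `L^{1/θ}` norm of an `ℝ≥0∞`-valued function, parametrised by the reciprocal exponent. -/
def recNorm (μ : Measure α) (θ : ℝ) (F : α → ℝ≥0∞) : ℝ≥0∞ :=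
  if θ = 0 then essSup F μ else (∫⁻ a, F a ^ (1 / θ) ∂μ) ^ θ

lemma recNorm_zero (μ : Measure α) (F : α → ℝ≥0∞) : recNorm μ 0 F = essSup F μ := by
  simp [recNorm]

lemma recNorm_of_ne {μ : Measure α} {θ : ℝ} (h : θ ≠ 0) (F : α → ℝ≥0∞) :
    recNorm μ θ F = (∫⁻ a, F a ^ (1 / θ) ∂μ) ^ θ := by
  simp [recNorm, h]

lemma recNorm_one (μ : Measure α) (F : α → ℝ≥0∞) : recNorm μ 1 F = ∫⁻ a, F a ∂μ := by
  simp [recNorm]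

lemma eNorm_eq_recNorm (μ : Measure α) {p : ℝ≥0∞} (hp : 1 ≤ p) (F : α → ℝ≥0∞) :
    eNorm μ p F = recNorm μ (1 / p).toReal F := by
  by_cases h : p = ∞
  · simp [eNorm, recNorm, h]
  · have h0 : p.toReal ≠ 0 := by
      have : p ≠ 0 := (zero_lt_one.trans_le hp).ne'
      exact (ENNReal.toReal_pos this h).ne'
    simp [eNorm, recNorm, h, h0]

lemma recNorm_mono {μ : Measure α} {θ : ℝ} (hθ : 0 ≤ θ) {F G : α → ℝ≥0∞} (h : ∀ a, F a ≤ G a) :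
    recNorm μ θ F ≤ recNorm μ θ G := by
  rcases hθ.eq_or_lt with rfl | hθ
  · simp only [recNorm_zero]
    exact essSup_mono_ae (Filter.Eventually.of_forall h)
  · rw [recNorm_of_ne hθ.ne', recNorm_of_ne hθ.ne']
    gcongr with a
    exact h a

lemma recNorm_const_mul {μ : Measure α} {θ : ℝ} (hθ : 0 ≤ θ) (c : ℝ≥0∞) {F : α → ℝ≥0∞}
    (hF : Measurable F) : recNorm μ θ (fun a => c * F a) = c * recNorm μ θ F := by
  rcases hθ.eq_or_lt with rfl | hθ
  · simp only [recNorm_zero]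
    exact ENNReal.essSup_const_mul
  · rw [recNorm_of_ne hθ.ne', recNorm_of_ne hθ.ne']
    have h1 : 0 ≤ 1 / θ := by positivity
    simp_rw [ENNReal.mul_rpow_of_nonneg _ _ h1]
    rw [lintegral_const_mul _ (hF.pow_const _), ENNReal.mul_rpow_of_nonneg _ _ hθ.le,
      ← ENNReal.rpow_mul, one_div_mul_cancel hθ.ne', ENNReal.rpow_one]

lemma recNorm_rpow {μ : Measure α} {θ s : ℝ} (hθ : 0 ≤ θ) (hs : 0 < s) (F : α → ℝ≥0∞) :
    recNorm μ θ (fun a => F a ^ s) = recNorm μ (θ / s) F ^ s := by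
  rcases hθ.eq_or_lt with rfl | hθ
  · simp only [zero_div, recNorm_zero]
    exact (OrderIso.essSup_apply F μ (ENNReal.orderIsoRpow s hs)).symm
  · have h2 : θ / s ≠ 0 := by positivity
    rw [recNorm_of_ne hθ.ne', recNorm_of_ne h2, ← ENNReal.rpow_mul, div_mul_cancel₀ _ hs.ne']
    simp_rw [← ENNReal.rpow_mul, one_div_div, mul_one_div]

lemma measurable_recNorm {ν : Measure β} [SFinite ν] (θ : ℝ) {F : α → β → ℝ≥0∞}
    (hF : Measurable (Function.uncurry F)) : Measurable fun a => recNorm ν θ (F a) := by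
  by_cases h : θ = 0
  · subst h
    simp only [recNorm_zero]
    refine measurable_of_Ioi fun c => ?_
    have : (fun a => essSup (F a) ν) ⁻¹' Set.Ioi c = {a | ν {b | c < F a b} ≠ 0} := by
      ext a
      simp only [Set.mem_preimage, Set.mem_Ioi, Set.mem_ofPred_eq]
      rw [← not_le, ← not_iff_not, not_not, not_not]
      constructor
      · intro h
        have := (ENNReal.ae_le_essSup (μ := ν) (F a)).mono fun b hb => hb.trans h
        simpa [ae_iff] using this
      · intro h
        refine essSup_le_of_ae_le c ?_
        change ∀ᵐ b ∂ν, F a b ≤ c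
        simpa [ae_iff] using h
    rw [this]
    have hm : Measurable fun a => ν (Prod.mk a ⁻¹' {p : α × β | c < F p.1 p.2}) :=
      measurable_measure_prodMk_left (measurableSet_lt measurable_const hF)
    exact hm (measurableSet_singleton 0).compl
  · simp only [recNorm_of_ne h]
    exact ((hF.pow_const _).lintegral_prod_right').pow_const _

lemma recNorm_map {μ : Measure α} {ν : Measure β} {θ : ℝ} {e : α → β}
    (he : MeasurePreserving e μ ν) {F : β → ℝ≥0∞} (hF : Measurable F) :
    recNorm μ θ (fun a => F (e a)) = recNorm ν θ F := by
  by_cases h : θ = 0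
  · subst h
    rw [recNorm_zero, recNorm_zero, ← he.map_eq,
      essSup_map_measure hF.aemeasurable he.measurable.aemeasurable]
    rfl
  · rw [recNorm_of_ne h, recNorm_of_ne h, he.lintegral_comp (hF.pow_const _)]

/-- Hölder's inequality. -/
lemma lintegral_mul_le_recNorm (μ : Measure α) {θ : ℝ} (h0 : 0 ≤ θ) (h1 : θ ≤ 1)
    {F G : α → ℝ≥0∞} (hF : Measurable F) (hG : Measurable G) :
    ∫⁻ a, F a * G a ∂μ ≤ recNorm μ θ F * recNorm μ (1 - θ) G := by
  rcases h0.eq_or_lt with rfl | h0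
  · rw [recNorm_zero, sub_zero, recNorm_one, ← lintegral_const_mul _ hG]
    refine lintegral_mono_ae ?_
    filter_upwards [ENNReal.ae_le_essSup (μ := μ) F] with a ha
    gcongr
  rcases h1.eq_or_lt with rfl | h1
  · rw [sub_self, recNorm_zero, recNorm_one, ← lintegral_mul_const _ hF]
    refine lintegral_mono_ae ?_
    filter_upwards [ENNReal.ae_le_essSup (μ := μ) G] with a ha
    gcongr
  · have hpq : (1 / θ).HolderConjugate (1 / (1 - θ)) := by
      rw [Real.holderConjugate_iff]
      refine ⟨by rw [lt_div_iff₀ h0]; linarith, by simp⟩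
    have := ENNReal.lintegral_mul_le_Lp_mul_Lq μ hpq hF.aemeasurable hG.aemeasurable
    rw [recNorm_of_ne h0.ne', recNorm_of_ne (by linarith)]
    simpa using this

/-- Converse of Hölder's inequality. -/
lemma recNorm_le_of_forall_lintegral_mul_le {μ : Measure α} [SigmaFinite μ] {θ : ℝ} (h0 : 0 ≤ θ)
    (h1 : θ ≤ 1) {B : α → ℝ≥0∞} (hB : Measurable B) {C : ℝ≥0∞}
    (h : ∀ H : α → ℝ≥0∞, Measurable H → ∫⁻ a, B a * H a ∂μ ≤ C * recNorm μ (1 - θ) H) :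
    recNorm μ θ B ≤ C := by
  rcases h0.eq_or_lt with rfl | h0
  · rw [recNorm_zero]
    by_contra! hlt
    obtain ⟨c, hc, hc'⟩ := exists_between hlt
    have hpos : μ {a | c < B a} ≠ 0 := by
      intro h0
      refine hc'.not_ge (essSup_le_of_ae_le c ?_)
      change ∀ᵐ b ∂μ, B b ≤ c
      simpa [ae_iff] using h0
    have hms : MeasurableSet {a | c < B a} := measurableSet_lt measurable_const hB
    obtain ⟨E, hE, hEs, hEpos, hEfin⟩ :=
      Measure.exists_subset_measure_lt_top hms (pos_iff_ne_zero.2 hpos)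
    have := h (E.indicator 1) (measurable_one.indicator hE)
    rw [sub_zero, recNorm_one, lintegral_indicator_one hE] at this
    have h2 : c * μ E ≤ C * μ E := by
      refine le_trans ?_ this
      rw [← lintegral_indicator_one hE, ← lintegral_const_mul _ (measurable_one.indicator hE)]
      refine lintegral_mono fun a => ?_
      by_cases ha : a ∈ E
      · have : c < B a := hEs ha
        simpa [ha] using this.le
      · simp [ha]
    rw [ENNReal.mul_le_mul_iff_left hEpos.ne' hEfin.ne] at h2
    exact absurd h2 hc.not_ge
  rcases h1.eq_or_lt with rfl | h1
  · have := h 1 measurable_one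
    rw [sub_self, recNorm_zero] at this
    rw [recNorm_one]
    refine (le_trans (by simp) this).trans ?_
    refine mul_le_of_le_one_right' (essSup_le_of_ae_le _ (Filter.Eventually.of_forall fun _ => ?_))
    simp
  have hθ : θ ≠ 0 := h0.ne'
  let Bn : ℕ → α → ℝ≥0∞ := fun n => (spanningSets μ n).indicator fun a => min (B a) n
  have hBn : ∀ n, Measurable (Bn n) := fun n =>
    (hB.min measurable_const).indicator (measurableSet_spanningSets μ n)
  have hle : ∀ n a, Bn n a ≤ B a := fun n a => by
    refine (Set.indicator_le_self' (by simp) a).trans (min_le_left _ _)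
  have key : ∀ n, (∫⁻ a, Bn n a ^ (1 / θ) ∂μ) ≤ C ^ (1 / θ) := by
    intro n
    set I := ∫⁻ a, Bn n a ^ (1 / θ) ∂μ with hI
    have hfin : I ≠ ∞ := by
      have : I ≤ ∫⁻ a, (spanningSets μ n).indicator (fun _ => (n : ℝ≥0∞) ^ (1 / θ)) a ∂μ := by
        refine lintegral_mono fun a => ?_
        by_cases ha : a ∈ spanningSets μ n
        · simp only [Bn, ha, Set.indicator_of_mem]
          gcongr
          exact min_le_right _ _
        · have : 0 < 1 / θ := by positivity
          simp only [Bn, ha, Set.indicator_of_notMem, not_false_eq_true]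
          simp [h0]
      rw [lintegral_indicator (measurableSet_spanningSets μ n), lintegral_const] at this
      refine ne_top_of_le_ne_top (ENNReal.mul_ne_top ?_ ?_) this
      · exact ENNReal.rpow_ne_top_of_nonneg (by positivity) (by simp)
      · simpa using (measure_spanningSets_lt_top μ n).ne
    have h2 := h (fun a => Bn n a ^ (1 / θ - 1)) ((hBn n).pow_const _)
    have h1θ : 1 - θ ≠ 0 := by linarith
    have h3 : (1 / θ - 1) * (1 / (1 - θ)) = 1 / θ := by
      field_simp
    rw [recNorm_of_ne h1θ] at h2
    simp_rw [← ENNReal.rpow_mul, h3] at h2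
    have h4 : I ≤ C * I ^ (1 - θ) := by
      refine le_trans (lintegral_mono fun a => ?_) h2
      have h5 : Bn n a ^ (1 / θ) = Bn n a * Bn n a ^ (1 / θ - 1) := by
        have : 0 ≤ 1 / θ - 1 := by
          rw [sub_nonneg, le_div_iff₀ h0]; linarith
        nth_rewrite 2 [← ENNReal.rpow_one (Bn n a)]
        rw [← ENNReal.rpow_add_of_nonneg _ _ zero_le_one this]
        congr 1; ring
      rw [h5]
      gcongr
      exact hle n a
    rcases eq_or_ne I 0 with hI0 | hI0
    · simp [hI0]
    have h6 : I ^ θ ≤ C := by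
      have h7 : I = I ^ θ * I ^ (1 - θ) := by
        rw [← ENNReal.rpow_add _ _ hI0 hfin]; simp
      nth_rewrite 1 [h7] at h4
      rwa [ENNReal.mul_le_mul_iff_left] at h4
      · simp [hI0, hfin]
      · simp [hI0, hfin]
    have := ENNReal.rpow_le_rpow h6 (show 0 ≤ 1 / θ by positivity)
    rwa [← ENNReal.rpow_mul, mul_one_div_cancel hθ, ENNReal.rpow_one] at this
  rw [recNorm_of_ne hθ]
  have hlim : ∫⁻ a, B a ^ (1 / θ) ∂μ ≤ C ^ (1 / θ) := by
    have hsup : ∀ a, B a ^ (1 / θ) ≤ ⨆ n, Bn n a ^ (1 / θ) := by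
      intro a
      obtain ⟨m, hm⟩ : ∃ m, a ∈ spanningSets μ m := by
        exact ⟨_, mem_spanningSetsIndex μ a⟩
      have hlim : Filter.Tendsto (fun n => Bn n a ^ (1 / θ)) Filter.atTop
          (nhds (B a ^ (1 / θ))) := by
        have h8 : Filter.Tendsto (fun n : ℕ => min (B a) (n : ℝ≥0∞)) Filter.atTop
            (nhds (B a)) := by
          simpa using tendsto_const_nhds.min ENNReal.tendsto_nat_nhds_top
        refine ((ENNReal.continuous_rpow_const.tendsto _).comp h8).congr' ?_
        filter_upwards [Filter.eventually_ge_atTop m] with n hn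
        simp [Bn, monotone_spanningSets μ hn hm]
      exact le_of_tendsto' hlim fun n => le_iSup (fun n => Bn n a ^ (1 / θ)) n
    have hmono : Monotone fun n a => Bn n a ^ (1 / θ) := by
      intro n m hnm a
      have : Bn n a ≤ Bn m a := by
        refine (Set.indicator_le_indicator_of_subset (monotone_spanningSets μ hnm)
          (by simp) a).trans (Set.indicator_le_indicator ?_)
        gcongr
      dsimp only
      gcongr
    refine (lintegral_mono hsup).trans ?_
    rw [lintegral_iSup (fun n => (hBn n).pow_const _) hmono]
    exact iSup_le key
  have := ENNReal.rpow_le_rpow hlim h0.le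
  rwa [← ENNReal.rpow_mul, one_div_mul_cancel hθ, ENNReal.rpow_one] at this

/-- Minkowski's integral inequality. -/
lemma recNorm_lintegral_le {μ : Measure α} [SigmaFinite μ] {ν : Measure β} [SFinite ν] {θ : ℝ}
    (h0 : 0 ≤ θ) (h1 : θ ≤ 1) {F : α → β → ℝ≥0∞} (hF : Measurable (Function.uncurry F)) :
    recNorm μ θ (fun a => ∫⁻ b, F a b ∂ν) ≤ ∫⁻ b, recNorm μ θ (fun a => F a b) ∂ν := by
  refine recNorm_le_of_forall_lintegral_mul_le h0 h1 hF.lintegral_prod_right' fun H hH => ?_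
  have hF' : ∀ a, Measurable (F a) := fun a => hF.comp measurable_prodMk_left
  have hF'' : ∀ b, Measurable fun a => F a b := fun b => hF.comp measurable_prodMk_right
  calc ∫⁻ a, (∫⁻ b, F a b ∂ν) * H a ∂μ
      = ∫⁻ a, ∫⁻ b, F a b * H a ∂ν ∂μ := by
        refine lintegral_congr fun a => ?_
        rw [lintegral_mul_const _ (hF' a)]
    _ = ∫⁻ b, ∫⁻ a, F a b * H a ∂μ ∂ν := by
        refine lintegral_lintegral_swap (Measurable.aemeasurable ?_)
        exact hF.mul (hH.comp measurable_fst)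
    _ ≤ ∫⁻ b, recNorm μ θ (fun a => F a b) * recNorm μ (1 - θ) H ∂ν := by
        refine lintegral_mono fun b => ?_
        exact lintegral_mul_le_recNorm μ h0 h1 (hF'' b) hH
    _ = _ := by
        rw [lintegral_mul_const]
        exact measurable_recNorm (F := fun b a => F a b) θ (hF.comp measurable_swap)

attribute [irreducible] recNorm

end LpTheory

section Young

variable {E : Type*} [AddCommGroup E] [MeasurableSpace E] [MeasurableAdd₂ E]
  {μ : Measure E} [SigmaFinite μ] [μ.IsAddLeftInvariant]

lemma lintegral_lintegral_mul_le_rpow {q w r : ℝ} (hq : 0 < q) (hw : 0 < w) (hr : 0 < r)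
    (hq1 : q ≤ 1) (hw1 : w ≤ 1) (hr1 : r ≤ 1) (hsum : q + w + r = 2) {F h k : E → ℝ≥0∞}
    (hF : Measurable F) (hh : Measurable h) (hk : Measurable k) :
    ∫⁻ z, ∫⁻ ξ, F ξ * h (z + ξ) * k z ∂μ ∂μ ≤
      recNorm μ q F * recNorm μ w h * recNorm μ r k := by
  rw [recNorm_of_ne hq.ne', recNorm_of_ne hw.ne', recNorm_of_ne hr.ne']
  set f := fun x => F x ^ (1 / q) with hf
  set g := fun x => h x ^ (1 / w) with hg
  set l := fun x => k x ^ (1 / r) with hl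
  have mf : Measurable f := hF.pow_const _
  have mg : Measurable g := hh.pow_const _
  have ml : Measurable l := hk.pow_const _
  have split : ∀ (x : ℝ≥0∞) {a b c : ℝ}, 0 < c → 0 ≤ a → 0 ≤ b → a + b = c →
      x = (x ^ (1 / c)) ^ a * (x ^ (1 / c)) ^ b := by
    intro x a b c hc ha hb hab
    rw [← ENNReal.rpow_add_of_nonneg _ _ ha hb, hab, ← ENNReal.rpow_mul,
      one_div_mul_cancel hc.ne', ENNReal.rpow_one]
  have split' : ∀ (x : ℝ≥0∞) {a b c : ℝ}, 0 ≤ a → 0 ≤ b → a + b = c →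
      x ^ c = x ^ a * x ^ b := by
    intro x a b c ha hb hab
    rw [← ENNReal.rpow_add_of_nonneg _ _ ha hb, hab]
  have hr' : 0 ≤ 1 - r := by linarith
  have hq' : 0 ≤ 1 - q := by linarith
  have hw' : 0 ≤ 1 - w := by linarith
  let φ : Fin 3 → E × E → ℝ≥0∞ :=
    ![fun p => f p.2 * g (p.1 + p.2), fun p => f p.2 * l p.1, fun p => g (p.1 + p.2) * l p.1]
  let e : Fin 3 → ℝ := ![1 - r, 1 - w, 1 - q]
  have m0 : Measurable fun p : E × E => f p.2 * g (p.1 + p.2) := by fun_prop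
  have m1 : Measurable fun p : E × E => f p.2 * l p.1 := by fun_prop
  have m2 : Measurable fun p : E × E => g (p.1 + p.2) * l p.1 := by fun_prop
  have key := ENNReal.lintegral_prod_norm_pow_le (μ := μ.prod μ) Finset.univ (f := φ) (p := e)
    (by
      intro i _
      fin_cases i
      · exact m0.aemeasurable
      · exact m1.aemeasurable
      · exact m2.aemeasurable)
    (by simp [Fin.sum_univ_three, e]; linarith)
    (by
      intro i _
      fin_cases i
      · exact hr'
      · exact hw'
      · exact hq')
  have i0 : ∫⁻ p : E × E, f p.2 * g (p.1 + p.2) ∂μ.prod μ = (∫⁻ x, f x ∂μ) * ∫⁻ x, g x ∂μ := by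
    rw [lintegral_prod_symm' _ m0]
    simp_rw [add_comm _ (_ : E)]
    have : ∀ y, ∫⁻ x, f y * g (y + x) ∂μ = f y * ∫⁻ x, g x ∂μ := by
      intro y
      rw [lintegral_const_mul _ (by fun_prop), lintegral_add_left_eq_self g y]
    simp_rw [this]
    rw [lintegral_mul_const _ mf]
  have i1 : ∫⁻ p : E × E, f p.2 * l p.1 ∂μ.prod μ = (∫⁻ x, f x ∂μ) * ∫⁻ x, l x ∂μ := by
    rw [lintegral_prod _ m1.aemeasurable]
    simp_rw [lintegral_mul_const _ mf]
    rw [lintegral_const_mul _ ml]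
  have i2 : ∫⁻ p : E × E, g (p.1 + p.2) * l p.1 ∂μ.prod μ
      = (∫⁻ x, g x ∂μ) * ∫⁻ x, l x ∂μ := by
    rw [lintegral_prod _ m2.aemeasurable]
    have : ∀ x, ∫⁻ y, g (x + y) * l x ∂μ = (∫⁻ x, g x ∂μ) * l x := by
      intro x
      rw [lintegral_mul_const _ (by fun_prop), lintegral_add_left_eq_self g x]
    simp_rw [this]
    rw [lintegral_const_mul _ ml]
  simp only [Fin.prod_univ_three, φ, e, Matrix.cons_val_zero, Matrix.cons_val_one,
    Matrix.cons_val] at key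
  rw [i0, i1, i2] at key
  simp_rw [ENNReal.mul_rpow_of_nonneg _ _ hr', ENNReal.mul_rpow_of_nonneg _ _ hw',
    ENNReal.mul_rpow_of_nonneg _ _ hq'] at key
  rw [← lintegral_prod (μ := μ) (ν := μ) (fun p : E × E => F p.2 * h (p.1 + p.2) * k p.1)
    (by fun_prop)]
  have hpt : ∀ p : E × E, F p.2 * h (p.1 + p.2) * k p.1 =
      f p.2 ^ (1 - r) * g (p.1 + p.2) ^ (1 - r) * (f p.2 ^ (1 - w) * l p.1 ^ (1 - w)) *
        (g (p.1 + p.2) ^ (1 - q) * l p.1 ^ (1 - q)) := by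
    intro p
    calc _ = (f p.2 ^ (1 - r) * f p.2 ^ (1 - w)) *
          (g (p.1 + p.2) ^ (1 - r) * g (p.1 + p.2) ^ (1 - q)) *
          (l p.1 ^ (1 - w) * l p.1 ^ (1 - q)) := by
          rw [← split (F p.2) hq hr' hw' (by linarith),
            ← split (h (p.1 + p.2)) hw hr' hq' (by linarith),
            ← split (k p.1) hr hw' hq' (by linarith)]
      _ = _ := by ring
  rw [lintegral_congr hpt]
  refine key.trans_eq ?_
  rw [split' (∫⁻ a, f a ∂μ) hr' hw' (by linarith : _ = q),
    split' (∫⁻ a, g a ∂μ) hr' hq' (by linarith : _ = w),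
    split' (∫⁻ a, l a ∂μ) hw' hq' (by linarith : _ = r)]
  ring

/-- Young's convolution inequality. -/
lemma recNorm_conv_le {q w m : ℝ} (hm : 0 ≤ m) (hq1 : q ≤ 1) (hw1 : w ≤ 1)
    (hsum : q + w = 1 + m) {F h : E → ℝ≥0∞} (hF : Measurable F) (hh : Measurable h) :
    recNorm μ m (fun z => ∫⁻ ξ, F ξ * h (z + ξ) ∂μ) ≤ recNorm μ q F * recNorm μ w h := by
  have hH : Measurable fun z => ∫⁻ ξ, F ξ * h (z + ξ) ∂μ :=
    Measurable.lintegral_prod_right' (f := fun p : E × E => F p.2 * h (p.1 + p.2)) (by fun_prop)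
  rcases hm.eq_or_lt with rfl | hm0
  · rw [recNorm_zero]
    refine essSup_le_of_ae_le _ (Filter.Eventually.of_forall fun z => ?_)
    have hw : w = 1 - q := by linarith
    refine (lintegral_mul_le_recNorm μ (by linarith) hq1 hF
      (hh.comp (measurable_const_add z))).trans_eq ?_
    rw [hw]
    congr 1
    exact recNorm_map (measurePreserving_add_left μ z) hh
  rcases (show m ≤ 1 by linarith).eq_or_lt with rfl | hm1
  · obtain rfl : q = 1 := by linarith
    obtain rfl : w = 1 := by linarith
    simp_rw [recNorm_one]
    rw [lintegral_lintegral_swap (by fun_prop), ← lintegral_mul_const _ hF]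
    refine lintegral_mono fun ξ => ?_
    rw [lintegral_const_mul _ (by fun_prop)]
    simp_rw [add_comm _ ξ]
    rw [lintegral_add_left_eq_self h ξ]
  refine recNorm_le_of_forall_lintegral_mul_le hm hm1.le hH fun k hk => ?_
  refine le_trans (le_of_eq ?_) (lintegral_lintegral_mul_le_rpow (q := q) (w := w) (r := 1 - m)
    (by linarith) (by linarith) (by linarith) hq1 hw1 (by linarith) (by linarith) hF hh hk)
  refine lintegral_congr fun z => ?_
  rw [lintegral_mul_const _ (by fun_prop)]

/-- A version of Young's inequality with an inner `L^{1/s}` norm. -/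
lemma recNorm_recNorm_mul_le {s q w m : ℝ} (hm : 0 ≤ m) (hqs : q ≤ s) (hws : w ≤ s)
    (hq : 0 ≤ q) (hw : 0 ≤ w) (hsum : q + w = s + m) {F h : E → ℝ≥0∞} (hF : Measurable F)
    (hh : Measurable h) :
    recNorm μ m (fun z => recNorm μ s fun ξ => F ξ * h (z + ξ)) ≤
      recNorm μ q F * recNorm μ w h := by
  rcases (hq.trans hqs).eq_or_lt with rfl | hs
  · obtain rfl : q = 0 := by linarith
    obtain rfl : w = 0 := by linarith
    obtain rfl : m = 0 := by linarith
    simp_rw [recNorm_zero]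
    refine essSup_le_of_ae_le _ (Filter.Eventually.of_forall fun z => ?_)
    refine (ENNReal.essSup_mul_le F fun ξ => h (z + ξ)).trans_eq ?_
    congr 1
    have := recNorm_map (θ := 0) (measurePreserving_add_left μ z) hh
    simpa [recNorm_zero] using this
  have e1 : ∀ {θ : ℝ} (_ : 0 ≤ θ) (G : E → ℝ≥0∞),
      recNorm μ (θ / s) (fun x => G x ^ (1 / s)) ^ s = recNorm μ θ G := by
    intro θ hθ G
    rw [recNorm_rpow (by positivity) (by positivity : 0 < 1 / s), ← ENNReal.rpow_mul,
      one_div_mul_cancel hs.ne', ENNReal.rpow_one]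
    congr 1
    field_simp
  rw [← e1 hm, ← e1 hq, ← e1 hw, ← ENNReal.mul_rpow_of_nonneg _ _ hs.le]
  refine ENNReal.rpow_le_rpow ?_ hs.le
  refine le_trans (le_of_eq ?_) (recNorm_conv_le (μ := μ) (q := q / s) (w := w / s) (m := m / s)
    (by positivity) (by rwa [div_le_one hs]) (by rwa [div_le_one hs])
    (by field_simp; linarith) (hF.pow_const _) (hh.pow_const _))
  congr 1
  funext z
  rw [recNorm_of_ne hs.ne', ← ENNReal.rpow_mul, mul_one_div_cancel hs.ne', ENNReal.rpow_one]
  refine lintegral_congr fun ξ => ?_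
  rw [ENNReal.mul_rpow_of_nonneg _ _ (by positivity)]

end Young

section Trilinear

variable {E : Type*} [AddCommGroup E] [MeasurableSpace E] [MeasurableAdd₂ E]
  {μ : Measure E} [SigmaFinite μ] [μ.IsAddLeftInvariant]

lemma measurable_recNorm_prod {α β : Type*} [MeasurableSpace α] [MeasurableSpace β]
    {ν : Measure β} [SFinite ν] (θ : ℝ) {F : α × β → ℝ≥0∞} (hF : Measurable F) :
    Measurable fun a => recNorm ν θ fun b => F (a, b) :=
  measurable_recNorm (F := fun a b => F (a, b)) θ hF

lemma recNorm_recNorm_sub_mul_le {s q w m : ℝ} (hm : 0 ≤ m) (hqs : q ≤ s) (hws : w ≤ s)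
    (hq : 0 ≤ q) (hw : 0 ≤ w) (hsum : q + w = s + m) {F h : E → ℝ≥0∞} (hF : Measurable F)
    (hh : Measurable h) :
    recNorm μ m (fun t => recNorm μ s fun x => F (x - t) * h x) ≤
      recNorm μ q F * recNorm μ w h := by
  refine le_trans (le_of_eq ?_) (recNorm_recNorm_mul_le hm hqs hws hq hw hsum hF hh)
  congr 1
  funext t
  have := recNorm_map (θ := s) (measurePreserving_add_left μ t)
    (F := fun x => F (x - t) * h x) (by simp_rw [sub_eq_add_neg]; fun_prop)
  simpa using this.symm

variable [MeasurableNeg E]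

/-- The mixed-norm estimate in the time variables. -/
lemma recNorm_time_le {r₀ r₁ r₂ P₀ P₁ P₂ a : ℝ} (hr₀ : 0 ≤ r₀) (hr₀1 : r₀ ≤ 1) (hr₁ : 0 ≤ r₁)
    (hr₁1 : r₁ ≤ 1) (hr₂ : 0 ≤ r₂) (hr₂1 : r₂ ≤ 1) (hP₀ : 0 ≤ P₀) (hP₀1 : P₀ ≤ 1) (hP₁ : 0 ≤ P₁)
    (hP₂ : 0 ≤ P₂) (hP₁r : P₁ ≤ 1 - r₀) (ha : 0 ≤ a) (har : a ≤ 1 - r₀)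
    (h1 : P₁ + a = (1 - r₀) + (1 - r₁)) (hP₂a : P₂ ≤ a) (hP₀a : 1 - P₀ ≤ a)
    (h2 : P₂ + (1 - P₀) = a + (1 - r₂)) {S : E × E × E → ℝ≥0∞} (hS : Measurable S)
    {F₁ F₂ : E → ℝ≥0∞} (hF₁ : Measurable F₁) (hF₂ : Measurable F₂) :
    recNorm μ P₀ (fun x => ∫⁻ t₂, ∫⁻ t₁, S (x, t₁, t₂) * (F₁ (x - t₁) * F₂ (x - t₂)) ∂μ ∂μ) ≤
      recNorm μ r₂ (fun t₂ => recNorm μ r₁ fun t₁ => recNorm μ r₀ fun x => S (x, t₁, t₂)) *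
        (recNorm μ P₁ F₁ * recNorm μ P₂ F₂) := by
  have hF₁' : Measurable fun p : E × E => F₁ (p.1 - p.2) := by
    simp_rw [sub_eq_add_neg]; fun_prop
  have hF₂' : Measurable fun p : E × E => F₂ (p.1 - p.2) := by
    simp_rw [sub_eq_add_neg]; fun_prop
  have mI : Measurable fun p : (E × E) × E =>
      S (p.1.1, p.2, p.1.2) * (F₁ (p.1.1 - p.2) * F₂ (p.1.1 - p.1.2)) := by
    have := hF₁'.comp (g := fun p : E × E => F₁ (p.1 - p.2))
      (f := fun p : (E × E) × E => (p.1.1, p.2)) (by fun_prop)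
    have := hF₂'.comp (g := fun p : E × E => F₂ (p.1 - p.2))
      (f := fun p : (E × E) × E => p.1) (by fun_prop)
    simp only [Function.comp_def] at *
    fun_prop
  have mI1 : Measurable fun p : E × E =>
      ∫⁻ t₁, S (p.1, t₁, p.2) * (F₁ (p.1 - t₁) * F₂ (p.1 - p.2)) ∂μ := mI.lintegral_prod_right'
  refine recNorm_le_of_forall_lintegral_mul_le hP₀ hP₀1 mI1.lintegral_prod_right' fun H hH => ?_
  have mW : Measurable fun p : E × E => F₂ (p.2 - p.1) * H p.2 := by
    have := hF₂'.comp measurable_swap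
    simp only [Function.comp_def, Prod.fst_swap, Prod.snd_swap] at this
    fun_prop
  have mW' : ∀ t₂, Measurable fun x => F₂ (x - t₂) * H x := fun t₂ =>
    mW.comp (measurable_prodMk_left (x := t₂))
  have mV : Measurable fun p : (E × E) × E =>
      F₁ (p.2 - p.1.2) * (F₂ (p.2 - p.1.1) * H p.2) := by
    have h3 := hF₁'.comp (g := fun p : E × E => F₁ (p.1 - p.2))
      (f := fun p : (E × E) × E => (p.2, p.1.2)) (by fun_prop)
    have h4 := mW.comp (f := fun p : (E × E) × E => (p.1.1, p.2)) (by fun_prop)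
    exact h3.mul h4
  have mN0 : Measurable fun p : E × E => recNorm μ r₀ fun x => S (x, p.2, p.1) :=
    measurable_recNorm_prod (F := fun p : (E × E) × E => S (p.2, p.1.2, p.1.1)) r₀ (by fun_prop)
  have mN1 : Measurable fun t₂ => recNorm μ r₁ fun t₁ => recNorm μ r₀ fun x => S (x, t₁, t₂) :=
    measurable_recNorm_prod (F := fun p : E × E => recNorm μ r₀ fun x => S (x, p.2, p.1)) r₁ mN0
  have mN2 : Measurable fun p : E × E =>
      recNorm μ (1 - r₀) fun x => F₁ (x - p.2) * (F₂ (x - p.1) * H x) :=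
    measurable_recNorm_prod (F := fun p : (E × E) × E =>
      F₁ (p.2 - p.1.2) * (F₂ (p.2 - p.1.1) * H p.2)) _ mV
  calc ∫⁻ x, (∫⁻ t₂, ∫⁻ t₁, S (x, t₁, t₂) * (F₁ (x - t₁) * F₂ (x - t₂)) ∂μ ∂μ) * H x ∂μ
      = ∫⁻ x, ∫⁻ t₂, (∫⁻ t₁, S (x, t₁, t₂) * (F₁ (x - t₁) * F₂ (x - t₂)) ∂μ) * H x ∂μ ∂μ := by
        refine lintegral_congr fun x => ?_
        rw [lintegral_mul_const]
        exact mI1.comp measurable_prodMk_left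
    _ = ∫⁻ t₂, ∫⁻ x, (∫⁻ t₁, S (x, t₁, t₂) * (F₁ (x - t₁) * F₂ (x - t₂)) ∂μ) * H x ∂μ ∂μ := by
        refine lintegral_lintegral_swap (Measurable.aemeasurable ?_)
        exact mI1.mul (hH.comp measurable_fst)
    _ = ∫⁻ t₂, ∫⁻ x, ∫⁻ t₁, S (x, t₁, t₂) * (F₁ (x - t₁) * (F₂ (x - t₂) * H x)) ∂μ ∂μ ∂μ := by
        refine lintegral_congr fun t₂ => lintegral_congr fun x => ?_
        rw [← lintegral_mul_const]
        · refine lintegral_congr fun t₁ => by ring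
        · exact mI.comp (measurable_prodMk_left (x := (x, t₂)))
    _ = ∫⁻ t₂, ∫⁻ t₁, ∫⁻ x, S (x, t₁, t₂) * (F₁ (x - t₁) * (F₂ (x - t₂) * H x)) ∂μ ∂μ ∂μ := by
        refine lintegral_congr fun t₂ => ?_
        refine lintegral_lintegral_swap (Measurable.aemeasurable ?_)
        have := mV.comp (f := fun p : E × E => ((t₂, p.2), p.1)) (by fun_prop)
        simp only [Function.comp_def] at this
        simp only [Function.uncurry_def]
        fun_prop
    _ ≤ ∫⁻ t₂, ∫⁻ t₁, recNorm μ r₀ (fun x => S (x, t₁, t₂)) *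
          recNorm μ (1 - r₀) (fun x => F₁ (x - t₁) * (F₂ (x - t₂) * H x)) ∂μ ∂μ := by
        refine lintegral_mono fun t₂ => lintegral_mono fun t₁ => ?_
        exact lintegral_mul_le_recNorm μ hr₀ hr₀1 (by fun_prop)
          (mV.comp (measurable_prodMk_left (x := (t₂, t₁))))
    _ ≤ ∫⁻ t₂, recNorm μ r₁ (fun t₁ => recNorm μ r₀ (fun x => S (x, t₁, t₂))) *
          recNorm μ (1 - r₁) (fun t₁ =>
            recNorm μ (1 - r₀) (fun x => F₁ (x - t₁) * (F₂ (x - t₂) * H x))) ∂μ := by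
        refine lintegral_mono fun t₂ => ?_
        refine lintegral_mul_le_recNorm μ hr₁ hr₁1 (mN0.comp measurable_prodMk_left) ?_
        exact mN2.comp (measurable_prodMk_left (x := t₂))
    _ ≤ ∫⁻ t₂, recNorm μ r₁ (fun t₁ => recNorm μ r₀ (fun x => S (x, t₁, t₂))) *
          (recNorm μ P₁ F₁ * recNorm μ a (fun x => F₂ (x - t₂) * H x)) ∂μ := by
        refine lintegral_mono fun t₂ => ?_
        gcongr
        exact recNorm_recNorm_sub_mul_le (by linarith) hP₁r har hP₁ ha h1 hF₁ (mW' t₂)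
    _ = recNorm μ P₁ F₁ * ∫⁻ t₂, recNorm μ r₁ (fun t₁ => recNorm μ r₀ (fun x => S (x, t₁, t₂))) *
          recNorm μ a (fun x => F₂ (x - t₂) * H x) ∂μ := by
        rw [← lintegral_const_mul]
        · refine lintegral_congr fun t₂ => by ring
        · exact mN1.mul (measurable_recNorm_prod a mW)
    _ ≤ recNorm μ P₁ F₁ * (recNorm μ r₂ (fun t₂ => recNorm μ r₁ (fun t₁ =>
          recNorm μ r₀ (fun x => S (x, t₁, t₂)))) *
          recNorm μ (1 - r₂) (fun t₂ => recNorm μ a (fun x => F₂ (x - t₂) * H x))) := by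
        gcongr
        exact lintegral_mul_le_recNorm μ hr₂ hr₂1 mN1 (measurable_recNorm_prod a mW)
    _ ≤ recNorm μ P₁ F₁ * (recNorm μ r₂ (fun t₂ => recNorm μ r₁ (fun t₁ =>
          recNorm μ r₀ (fun x => S (x, t₁, t₂)))) *
          (recNorm μ P₂ F₂ * recNorm μ (1 - P₀) H)) := by
        gcongr
        exact recNorm_recNorm_sub_mul_le (by linarith) hP₂a hP₀a hP₂ (by linarith) h2 hF₂ hH
    _ = _ := by ring

/-- The mixed-norm estimate in the frequency variables. -/
lemma recNorm_freq_le {s₁ s₂ s₃ Q₁ Q₂ Q₃ a : ℝ} (hs₁ : 0 ≤ s₁) (hs₁1 : s₁ ≤ 1) (hs₂ : 0 ≤ s₂)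
    (hs₂1 : s₂ ≤ 1) (hs₃ : 0 ≤ s₃) (hs₃1 : s₃ ≤ 1) (hQ₃ : 0 ≤ Q₃) (hQ₃1 : Q₃ ≤ 1) (hQ₁ : 0 ≤ Q₁)
    (hQ₂ : 0 ≤ Q₂) (hQ₁s : Q₁ ≤ 1 - s₁) (hQ₃s : 1 - Q₃ ≤ 1 - s₁) (ha : 0 ≤ a)
    (h1 : Q₁ + (1 - Q₃) = (1 - s₁) + a) (hQ₂s : Q₂ ≤ 1 - s₂) (has : a ≤ 1 - s₂)
    (h2 : Q₂ + a = (1 - s₂) + (1 - s₃)) {S : E × E × E → ℝ≥0∞} (hS : Measurable S)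
    {F₁ F₂ : E → ℝ≥0∞} (hF₁ : Measurable F₁) (hF₂ : Measurable F₂) :
    recNorm μ Q₃ (fun ω => ∫⁻ ξ₂, ∫⁻ ξ₁, S (ξ₁, ξ₂, ω - ξ₁ - ξ₂) * (F₁ ξ₁ * F₂ ξ₂) ∂μ ∂μ) ≤
      recNorm μ s₃ (fun ν => recNorm μ s₂ fun ξ₂ => recNorm μ s₁ fun ξ₁ => S (ξ₁, ξ₂, ν)) *
        (recNorm μ Q₁ F₁ * recNorm μ Q₂ F₂) := by
  have mI : Measurable fun p : (E × E) × E =>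
      S (p.2, p.1.2, p.1.1 - p.2 - p.1.2) * (F₁ p.2 * F₂ p.1.2) := by
    simp_rw [sub_eq_add_neg]; fun_prop
  have mI1 : Measurable fun p : E × E =>
      ∫⁻ ξ₁, S (ξ₁, p.2, p.1 - ξ₁ - p.2) * (F₁ ξ₁ * F₂ p.2) ∂μ := mI.lintegral_prod_right'
  refine recNorm_le_of_forall_lintegral_mul_le hQ₃ hQ₃1 mI1.lintegral_prod_right' fun H hH => ?_
  have mJ : Measurable fun p : (E × E) × E =>
      S (p.2, p.1.2, p.1.1) * (F₁ p.2 * H (p.1.1 + p.1.2 + p.2)) * F₂ p.1.2 := by fun_prop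
  have mJ1 : Measurable fun p : E × E =>
      ∫⁻ ξ₁, S (ξ₁, p.2, p.1) * (F₁ ξ₁ * H (p.1 + p.2 + ξ₁)) * F₂ p.2 ∂μ :=
    mJ.lintegral_prod_right'
  set K : E → ℝ≥0∞ := fun z => recNorm μ (1 - s₁) fun ξ₁ => F₁ ξ₁ * H (z + ξ₁) with hK
  have mK : Measurable K := measurable_recNorm_prod (F := fun p : E × E => F₁ p.2 * H (p.1 + p.2))
    (1 - s₁) (by fun_prop)
  have mN1 : Measurable fun p : E × E => recNorm μ s₁ fun ξ₁ => S (ξ₁, p.2, p.1) :=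
    measurable_recNorm_prod (F := fun p : (E × E) × E => S (p.2, p.1.2, p.1.1)) s₁ (by fun_prop)
  have mN2 : Measurable fun ν => recNorm μ s₂ fun ξ₂ => recNorm μ s₁ fun ξ₁ => S (ξ₁, ξ₂, ν) :=
    measurable_recNorm_prod (F := fun p : E × E => recNorm μ s₁ fun ξ₁ => S (ξ₁, p.2, p.1)) s₂ mN1
  have mL : Measurable fun ν => recNorm μ (1 - s₂) fun ξ₂ => F₂ ξ₂ * K (ν + ξ₂) :=
    measurable_recNorm_prod (F := fun p : E × E => F₂ p.2 * K (p.1 + p.2)) _ (by fun_prop)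
  calc ∫⁻ ω, (∫⁻ ξ₂, ∫⁻ ξ₁, S (ξ₁, ξ₂, ω - ξ₁ - ξ₂) * (F₁ ξ₁ * F₂ ξ₂) ∂μ ∂μ) * H ω ∂μ
      = ∫⁻ ω, ∫⁻ ξ₂, ∫⁻ ξ₁, S (ξ₁, ξ₂, ω - ξ₁ - ξ₂) * (F₁ ξ₁ * F₂ ξ₂) * H ω ∂μ ∂μ ∂μ := by
        refine lintegral_congr fun ω => ?_
        rw [← lintegral_mul_const]
        · refine lintegral_congr fun ξ₂ => ?_
          rw [lintegral_mul_const]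
          exact mI.comp (measurable_prodMk_left (x := (ω, ξ₂)))
        · exact mI1.comp measurable_prodMk_left
    _ = ∫⁻ ξ₂, ∫⁻ ω, ∫⁻ ξ₁, S (ξ₁, ξ₂, ω - ξ₁ - ξ₂) * (F₁ ξ₁ * F₂ ξ₂) * H ω ∂μ ∂μ ∂μ := by
        refine lintegral_lintegral_swap (Measurable.aemeasurable ?_)
        have : Measurable fun p : (E × E) × E =>
            S (p.2, p.1.2, p.1.1 - p.2 - p.1.2) * (F₁ p.2 * F₂ p.1.2) * H p.1.1 :=
          mI.mul (by fun_prop)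
        exact this.lintegral_prod_right'
    _ = ∫⁻ ξ₂, ∫⁻ ξ₁, ∫⁻ ω, S (ξ₁, ξ₂, ω - ξ₁ - ξ₂) * (F₁ ξ₁ * F₂ ξ₂) * H ω ∂μ ∂μ ∂μ := by
        refine lintegral_congr fun ξ₂ => ?_
        refine lintegral_lintegral_swap (Measurable.aemeasurable ?_)
        simp only [Function.uncurry_def]
        simp_rw [sub_eq_add_neg]; fun_prop
    _ = ∫⁻ ξ₂, ∫⁻ ξ₁, ∫⁻ ν, S (ξ₁, ξ₂, ν) * (F₁ ξ₁ * H (ν + ξ₂ + ξ₁)) * F₂ ξ₂ ∂μ ∂μ ∂μ := by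
        refine lintegral_congr fun ξ₂ => lintegral_congr fun ξ₁ => ?_
        rw [← lintegral_add_left_eq_self _ (ξ₁ + ξ₂)]
        refine lintegral_congr fun ν => ?_
        have e1 : ξ₁ + ξ₂ + ν - ξ₁ - ξ₂ = ν := by abel
        have e2 : ξ₁ + ξ₂ + ν = ν + ξ₂ + ξ₁ := by abel
        rw [e1, e2]
        ring
    _ = ∫⁻ ξ₂, ∫⁻ ν, ∫⁻ ξ₁, S (ξ₁, ξ₂, ν) * (F₁ ξ₁ * H (ν + ξ₂ + ξ₁)) * F₂ ξ₂ ∂μ ∂μ ∂μ := by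
        refine lintegral_congr fun ξ₂ => ?_
        refine lintegral_lintegral_swap (Measurable.aemeasurable ?_)
        simp only [Function.uncurry_def]
        fun_prop
    _ = ∫⁻ ν, ∫⁻ ξ₂, ∫⁻ ξ₁, S (ξ₁, ξ₂, ν) * (F₁ ξ₁ * H (ν + ξ₂ + ξ₁)) * F₂ ξ₂ ∂μ ∂μ ∂μ :=
        lintegral_lintegral_swap (mJ1.comp measurable_swap).aemeasurable
    _ ≤ ∫⁻ ν, ∫⁻ ξ₂, recNorm μ s₁ (fun ξ₁ => S (ξ₁, ξ₂, ν)) * (F₂ ξ₂ * K (ν + ξ₂)) ∂μ ∂μ := by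
        refine lintegral_mono fun ν => lintegral_mono fun ξ₂ => ?_
        dsimp only
        rw [lintegral_mul_const _ (by fun_prop), mul_comm (F₂ ξ₂), ← mul_assoc]
        gcongr
        exact lintegral_mul_le_recNorm μ hs₁ hs₁1 (by fun_prop) (by fun_prop)
    _ ≤ ∫⁻ ν, recNorm μ s₂ (fun ξ₂ => recNorm μ s₁ (fun ξ₁ => S (ξ₁, ξ₂, ν))) *
          recNorm μ (1 - s₂) (fun ξ₂ => F₂ ξ₂ * K (ν + ξ₂)) ∂μ := by
        refine lintegral_mono fun ν => ?_
        exact lintegral_mul_le_recNorm μ hs₂ hs₂1 (mN1.comp measurable_prodMk_left) (by fun_prop)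
    _ ≤ recNorm μ s₃ (fun ν => recNorm μ s₂ (fun ξ₂ => recNorm μ s₁ (fun ξ₁ => S (ξ₁, ξ₂, ν)))) *
          recNorm μ (1 - s₃) (fun ν => recNorm μ (1 - s₂) (fun ξ₂ => F₂ ξ₂ * K (ν + ξ₂))) :=
        lintegral_mul_le_recNorm μ hs₃ hs₃1 mN2 mL
    _ ≤ recNorm μ s₃ (fun ν => recNorm μ s₂ (fun ξ₂ => recNorm μ s₁ (fun ξ₁ => S (ξ₁, ξ₂, ν)))) *
          (recNorm μ Q₂ F₂ * (recNorm μ Q₁ F₁ * recNorm μ (1 - Q₃) H)) := by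
        gcongr
        refine (recNorm_recNorm_mul_le (by linarith) hQ₂s has hQ₂ ha h2 hF₂ mK).trans ?_
        gcongr
        exact recNorm_recNorm_mul_le ha hQ₁s hQ₃s hQ₁ (by linarith) h1 hF₁ hH
    _ = _ := by ring

end Trilinear

section Gaussian

variable {d : ℕ}

@[simp]
lemma norm_e2pi (a : ℝ) : ‖e2pi a‖ = 1 := by
  rw [e2pi, show 2 * (Real.pi : ℂ) * I * (a : ℂ) = ((2 * Real.pi * a : ℝ) : ℂ) * I by
    push_cast; ring, norm_exp_ofReal_mul_I]

@[simp]
lemma enorm_e2pi (a : ℝ) : ‖e2pi a‖ₑ = 1 := by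
  rw [← ofReal_norm, norm_e2pi, ENNReal.ofReal_one]

lemma e2pi_add (a b : ℝ) : e2pi (a + b) = e2pi a * e2pi b := by
  rw [e2pi, e2pi, e2pi, ← Complex.exp_add]
  push_cast
  ring_nf

@[fun_prop]
lemma continuous_e2pi : Continuous e2pi := by
  unfold e2pi
  fun_prop

@[fun_prop]
lemma measurable_e2pi : Measurable e2pi := continuous_e2pi.measurable

/-- The real Gaussian `e^{-b‖x‖²}`. -/
def gs (b : ℝ) (x : Ed d) : ℝ := Real.exp (-b * ‖x‖ ^ 2)

/-- The total mass of the Gaussian `gs b` on `ℝ^d`. -/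
def gaussMass (d : ℕ) (b : ℝ) : ℝ := (Real.pi / b) ^ ((d : ℝ) / 2)

lemma gaussMass_pos (d : ℕ) {b : ℝ} (hb : 0 < b) : 0 < gaussMass d b :=
  Real.rpow_pos_of_pos (div_pos Real.pi_pos hb) _

lemma gs_pos (b : ℝ) (x : Ed d) : 0 < gs b x := Real.exp_pos _

lemma gs_le_one {b : ℝ} (hb : 0 ≤ b) (x : Ed d) : gs b x ≤ 1 := by
  rw [gs, Real.exp_le_one_iff]
  have := mul_nonneg hb (sq_nonneg ‖x‖)
  linarith

@[fun_prop]
lemma continuous_gs (b : ℝ) : Continuous (gs b : Ed d → ℝ) := by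
  unfold gs
  fun_prop

@[fun_prop]
lemma measurable_gs (b : ℝ) : Measurable (gs b : Ed d → ℝ) := (continuous_gs b).measurable

lemma gauss_eq_gs : gauss d = fun x => ((gs 1 x : ℝ) : ℂ) := by
  funext x
  simp [gauss, gs]

lemma gs_mul_gs (a b : ℝ) (x : Ed d) : gs a x * gs b x = gs (a + b) x := by
  rw [gs, gs, gs, ← Real.exp_add]
  ring_nf

lemma gs_neg (b : ℝ) (x : Ed d) : gs b (-x) = gs b x := by
  simp [gs]

lemma integrable_gs {b : ℝ} (hb : 0 < b) : Integrable (gs b : Ed d → ℝ) := by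
  have := (GaussianFourier.integrable_cexp_neg_mul_sq_norm_add (V := Ed d) (b := (b : ℂ))
    (by simpa using hb) 0 0).norm
  refine this.congr (Filter.Eventually.of_forall fun v => ?_)
  simp only [gs, Complex.norm_exp]
  congr 1
  simp [← Complex.ofReal_pow]

lemma integral_gs_mul_e2pi {b : ℝ} (hb : 0 < b) (w : Ed d) :
    ∫ v : Ed d, (gs b v : ℂ) * e2pi ⟪w, v⟫ = gaussMass d b * gs (Real.pi ^ 2 / b) w := by
  have h := GaussianFourier.integral_cexp_neg_mul_sq_norm_add (V := Ed d) (b := (b : ℂ))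
    (by simpa using hb) (2 * Real.pi * I) w
  have e1 : ∀ v : Ed d, (gs b v : ℂ) * e2pi ⟪w, v⟫ =
      cexp (-(b : ℂ) * (‖v‖ : ℂ) ^ 2 + 2 * Real.pi * I * (⟪w, v⟫ : ℂ)) := by
    intro v
    rw [gs, e2pi, Complex.exp_add]
    push_cast
    rfl
  rw [integral_congr_ae (Filter.Eventually.of_forall e1), h, gaussMass, gs]
  have hb' : (b : ℂ) ≠ 0 := by exact_mod_cast hb.ne'
  congr 1
  · rw [finrank_euclideanSpace, Fintype.card_fin, Complex.ofReal_cpow (by positivity)]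
    push_cast
    rfl
  · push_cast
    congr 1
    field_simp
    rw [I_sq]
    ring

lemma integral_gs {b : ℝ} (hb : 0 < b) : ∫ v : Ed d, gs b v = gaussMass d b := by
  have := integral_gs_mul_e2pi (d := d) hb 0
  simp only [inner_zero_left, e2pi, gs, Complex.ofReal_zero, mul_zero, Complex.exp_zero, mul_one,
    norm_zero, ne_eq, OfNat.ofNat_ne_zero, not_false_eq_true, zero_pow, Real.exp_zero,
    Complex.ofReal_one] at this
  rw [integral_complex_ofReal] at this
  exact_mod_cast this

lemma lintegral_gs {b : ℝ} (hb : 0 < b) :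
    ∫⁻ v : Ed d, ENNReal.ofReal (gs b v) = ENNReal.ofReal (gaussMass d b) := by
  rw [← integral_gs hb, ofReal_integral_eq_lintegral_ofReal (integrable_gs hb)
    (Filter.Eventually.of_forall fun v => (gs_pos b v).le)]

/-- A Gaussian is a convolution of two narrower Gaussians. -/
lemma integral_gs_sub_mul_gs (y : Ed d) :
    ∫ u : Ed d, gs 2 (y - u) * gs 2 u = gaussMass d 4 * gs 1 y := by
  have e1 : ∀ u : Ed d, gs 2 (y - u) * gs 2 u = gs 1 y * gs 4 (u - (1 / 2 : ℝ) • y) := by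
    intro u
    rw [gs, gs, gs, gs, ← Real.exp_add, ← Real.exp_add]
    congr 1
    rw [norm_sub_sq_real, norm_sub_sq_real, norm_smul, inner_smul_right, real_inner_comm u y]
    simp only [Real.norm_eq_abs, mul_pow, sq_abs]
    ring
  simp_rw [e1]
  rw [integral_const_mul, integral_sub_right_eq_self (fun u => gs 4 u), integral_gs (by norm_num),
    mul_comm]

/-- The Weyl-type symbol `e^{-‖y‖²/2 - 2π²‖η‖²} e^{2πi⟪y,η⟫}` as a superposition of characters. -/
lemma integral_integral_gs_mul_e2pi (y η : Ed d) :
    ∫ ν : Ed d, (gs (Real.pi ^ 2) ν : ℂ) * e2pi ⟪y, ν⟫ *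
      ∫ t : Ed d, (gs (1 / 4) t : ℂ) * e2pi ⟪η - (1 / 2 : ℝ) • ν, t⟫ =
    (gaussMass d (1 / 4) * gaussMass d (2 * Real.pi ^ 2) : ℝ) *
      ((gs (1 / 2) y * gs (2 * Real.pi ^ 2) η : ℝ) * e2pi ⟪y, η⟫) := by
  have hpi : (0 : ℝ) < Real.pi ^ 2 := by positivity
  simp_rw [integral_gs_mul_e2pi (show (0 : ℝ) < 1 / 4 by norm_num)]
  have e1 : ∀ ν : Ed d, (gs (Real.pi ^ 2) ν : ℂ) * e2pi ⟪y, ν⟫ *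
      (gaussMass d (1 / 4) * gs (Real.pi ^ 2 / (1 / 4)) (η - (1 / 2 : ℝ) • ν)) =
      gaussMass d (1 / 4) * gs (2 * Real.pi ^ 2) η * e2pi ⟪y, η⟫ *
        ((gs (2 * Real.pi ^ 2) (ν - η) : ℂ) * e2pi ⟪y, ν - η⟫) := by
    intro ν
    have h1 : gs (Real.pi ^ 2) ν * gs (Real.pi ^ 2 / (1 / 4)) (η - (1 / 2 : ℝ) • ν) =
        gs (2 * Real.pi ^ 2) η * gs (2 * Real.pi ^ 2) (ν - η) := by
      rw [gs, gs, gs, gs, ← Real.exp_add, ← Real.exp_add]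
      congr 1
      rw [norm_sub_sq_real, norm_sub_sq_real, norm_smul, inner_smul_right, real_inner_comm η ν]
      simp only [Real.norm_eq_abs, mul_pow, sq_abs]
      ring
    have h2 : e2pi ⟪y, ν⟫ = e2pi ⟪y, η⟫ * e2pi ⟪y, ν - η⟫ := by
      rw [← e2pi_add, ← inner_add_right, add_sub_cancel]
    have h1' : (gs (Real.pi ^ 2) ν : ℂ) * gs (Real.pi ^ 2 / (1 / 4)) (η - (1 / 2 : ℝ) • ν) =
        gs (2 * Real.pi ^ 2) η * gs (2 * Real.pi ^ 2) (ν - η) := by exact_mod_cast h1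
    rw [h2]
    linear_combination (gaussMass d (1 / 4) : ℂ) * e2pi ⟪y, η⟫ * e2pi ⟪y, ν - η⟫ * h1'
  simp_rw [e1]
  rw [integral_const_mul,
    integral_sub_right_eq_self (fun ν : Ed d => (gs (2 * Real.pi ^ 2) ν : ℂ) * e2pi ⟪y, ν⟫),
    integral_gs_mul_e2pi (by positivity),
    show Real.pi ^ 2 / (2 * Real.pi ^ 2) = 1 / 2 by field_simp]
  push_cast
  ring

end Gaussian

section WindowChange

variable {E : Type*} [AddCommGroup E] [MeasurableSpace E] [MeasurableAdd₂ E]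
  {μ : Measure E} [SigmaFinite μ] [μ.IsAddLeftInvariant]

lemma recNorm_le_of_le_conv {P P' : ℝ} (hP' : 0 ≤ P') (hPP : P' ≤ P) (hP : P ≤ 1)
    {F G g : E → ℝ≥0∞} (hG : Measurable G) (hg : Measurable g) {A : ℝ≥0∞}
    (h : ∀ t, F t ≤ A * ∫⁻ u, g u * G (t + u) ∂μ) :
    recNorm μ P' F ≤ A * (recNorm μ (1 + P' - P) g * recNorm μ P G) := by
  have mI : Measurable fun t => ∫⁻ u, g u * G (t + u) ∂μ :=
    Measurable.lintegral_prod_right' (f := fun p : E × E => g p.2 * G (p.1 + p.2)) (by fun_prop)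
  refine (recNorm_mono hP' h).trans ?_
  rw [recNorm_const_mul hP' _ mI]
  gcongr
  exact recNorm_conv_le hP' (by linarith) hP (by ring) hg hG

lemma recNorm_recNorm_le_of_le_conv {P P' Q Q' : ℝ} (hP' : 0 ≤ P') (hPP : P' ≤ P) (hP : P ≤ 1)
    (hQ' : 0 ≤ Q') (hQQ : Q' ≤ Q) (hQ : Q ≤ 1) {V W : E × E → ℝ≥0∞} {g k : E → ℝ≥0∞}
    (hV : Measurable V) (hW : Measurable W) (hg : Measurable g) (hk : Measurable k) {A B : ℝ≥0∞}
    (h₁ : ∀ t ν, V (t, ν) ≤ A * ∫⁻ u, g u * W (t + u, ν) ∂μ)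
    (h₂ : ∀ t ν, W (t, ν) ≤ B * ∫⁻ u, k u * V (t, ν + u) ∂μ) :
    recNorm μ Q' (fun ν => recNorm μ P' fun t => V (t, ν)) ≤
      A * recNorm μ (1 + P' - P) g * B * recNorm μ (1 + Q' - Q) k *
        recNorm μ Q (fun ν => recNorm μ P fun t => V (t, ν)) := by
  have hP0 := hP'.trans hPP
  have mN : Measurable fun ν => recNorm μ P fun t => V (t, ν) :=
    measurable_recNorm (F := fun ν t => V (t, ν)) P (hV.comp measurable_swap)
  rw [mul_assoc _ (recNorm μ (1 + Q' - Q) k)]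
  refine recNorm_le_of_le_conv hQ' hQQ hQ mN hk fun ν => ?_
  refine (recNorm_le_of_le_conv hP' hPP hP (hW.comp (measurable_prodMk_right (y := ν))) hg
    fun t => h₁ t ν).trans ?_
  rw [mul_assoc, mul_assoc]
  refine mul_le_mul_right (mul_le_mul_right ?_ _) _
  have mJ : Measurable fun p : E × E => k p.2 * V (p.1, ν + p.2) := by fun_prop
  refine (recNorm_mono hP0 fun t => h₂ t ν).trans ?_
  rw [recNorm_const_mul hP0 _ mJ.lintegral_prod_right']
  refine mul_le_mul_right ((recNorm_lintegral_le (F := fun t u => k u * V (t, ν + u)) hP0 hP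
    mJ).trans ?_) _
  refine lintegral_mono fun u => le_of_eq ?_
  exact recNorm_const_mul (F := fun t => V (t, ν + u)) hP0 _ (by fun_prop)

end WindowChange

section ShortTime

lemma enorm_integral_integral_le {X Y : Type*} [MeasurableSpace X] [MeasurableSpace Y]
    {μ : Measure X} {ν : Measure Y} [SFinite μ] [SFinite ν] {f : X → Y → ℂ}
    (hf : Integrable (Function.uncurry f) (μ.prod ν)) :
    ‖∫ x, ∫ y, f x y ∂ν ∂μ‖ₑ ≤ ∫⁻ y, ‖∫ x, f x y ∂μ‖ₑ ∂ν := by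
  rw [integral_integral_swap hf]
  exact enorm_integral_le_lintegral_enorm _

/-- A shear of a product of integrable functions is integrable. -/
lemma integrable_mul_comp_sub {X V : Type*} [MeasurableSpace X] {μ : Measure X} [SFinite μ]
    [AddCommGroup V] [MeasurableSpace V] [MeasurableAdd₂ V] [MeasurableNeg V] {ν : Measure V}
    [SFinite ν] [ν.IsAddLeftInvariant] {H : X → ℂ} {W : V → ℂ} {p : X → V}
    (hH : Integrable H μ) (hW : Integrable W ν) (hWm : Measurable W) (hp : Measurable p) :
    Integrable (fun q : X × V => H q.1 * W (q.2 - p q.1)) (μ.prod ν) := by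
  have hmeas : AEStronglyMeasurable (fun q : X × V => H q.1 * W (q.2 - p q.1)) (μ.prod ν) := by
    refine hH.1.comp_fst.mul (Measurable.aestronglyMeasurable ?_)
    simp_rw [sub_eq_add_neg]
    fun_prop
  rw [integrable_prod_iff hmeas]
  constructor
  · refine Filter.Eventually.of_forall fun x => ?_
    exact (hW.comp_sub_right (p x)).const_mul (H x)
  · have e : (fun x => ∫ y, ‖H x * W (y - p x)‖ ∂ν) = fun x => ‖H x‖ * ∫ y, ‖W y‖ ∂ν := by
      funext x
      simp_rw [norm_mul]
      rw [integral_const_mul, integral_sub_right_eq_self (fun y => ‖W y‖)]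
    simp only [e]
    exact hH.norm.mul_const _

variable {d : ℕ}

/-- The Gaussian `gs b` as a complex-valued window. -/
def gw (b : ℝ) : Ed d → ℂ := fun x => (gs b x : ℂ)

lemma gauss_eq_gw : gauss d = gw 1 := gauss_eq_gs

@[fun_prop]
lemma continuous_gw (b : ℝ) : Continuous (gw b : Ed d → ℂ) := by
  unfold gw
  fun_prop

@[fun_prop]
lemma measurable_gw (b : ℝ) : Measurable (gw b : Ed d → ℂ) := (continuous_gw b).measurable

lemma integrable_gw {b : ℝ} (hb : 0 < b) : Integrable (gw b : Ed d → ℂ) := (integrable_gs hb).ofReal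

lemma enorm_gw (b : ℝ) (x : Ed d) : ‖gw b x‖ₑ = ENNReal.ofReal (gs b x) := by
  rw [gw, ← ofReal_norm, Complex.norm_real, Real.norm_of_nonneg (gs_pos b x).le]

lemma gw_sub_comm (b : ℝ) (x y : Ed d) : gw b (x - y) = gw b (y - x) := by
  rw [gw, gw, ← neg_sub, gs_neg]

lemma gw_mul_gw (a b : ℝ) (x : Ed d) : gw a x * gw b x = gw (a + b) x := by
  rw [gw, gw, gw, ← gs_mul_gs, Complex.ofReal_mul]

lemma measurable_STFT (b : ℝ) {f : Ed d → ℂ} (hf : Measurable f) :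
    Measurable fun p : Ed d × Ed d => STFT d (gw b) f p.1 p.2 := by
  unfold STFT
  refine StronglyMeasurable.measurable (StronglyMeasurable.integral_prod_right'
    (f := fun q : (Ed d × Ed d) × Ed d => f q.2 * e2pi (-⟪q.2, q.1.2⟫) * gw b (q.2 - q.1.1)) ?_)
  exact Measurable.stronglyMeasurable (by fun_prop)

lemma enorm_STFT_one_le {f : Ed d → ℂ} (hf : Measurable f) {M : ℝ} (hM : ∀ x, ‖f x‖ ≤ M)
    (t ν : Ed d) :
    ‖STFT d (gw 1) f t ν‖ₑ ≤ ENNReal.ofReal (gaussMass d 4)⁻¹ *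
      ∫⁻ u, ENNReal.ofReal (gs 2 u) * ‖STFT d (gw 2) f (t + u) ν‖ₑ := by
  have hc := gaussMass_pos d (b := 4) (by norm_num)
  have e1 : STFT d (gw 1) f t ν = ((gaussMass d 4)⁻¹ : ℝ) *
      ∫ y, ∫ u, f y * e2pi (-⟪y, ν⟫) * gw 2 (y - (t + u)) * gw 2 u := by
    rw [STFT, ← integral_const_mul]
    refine integral_congr_ae (Filter.Eventually.of_forall fun y => ?_)
    have h := integral_gs_sub_mul_gs (y - t)
    have h' : ∫ u : Ed d, gw 2 (y - (t + u)) * gw 2 u = gaussMass d 4 * gw 1 (y - t) := by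
      simp only [gw, ← Complex.ofReal_mul, ← h, ← sub_sub]
      exact integral_complex_ofReal
    simp only [mul_assoc]
    rw [integral_const_mul, integral_const_mul, h', Complex.ofReal_inv]
    have hc' : (gaussMass d 4 : ℂ) ≠ 0 := by exact_mod_cast hc.ne'
    field_simp
  rw [e1, enorm_mul]
  have e2 : ‖(((gaussMass d 4)⁻¹ : ℝ) : ℂ)‖ₑ = ENNReal.ofReal (gaussMass d 4)⁻¹ := by
    rw [← ofReal_norm, Complex.norm_real, Real.norm_of_nonneg (by positivity)]
  rw [e2]
  gcongr
  refine (enorm_integral_integral_le ?_).trans (lintegral_mono fun u => ?_)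
  · have h1 := (integrable_mul_comp_sub (integrable_gw (d := d) (b := 2) (by norm_num))
      (integrable_gw (d := d) (b := 2) (by norm_num)) (by fun_prop)
      (p := fun u => t + u) (by fun_prop)).swap
    refine (h1.bdd_mul (c := M) (f := fun q : Ed d × Ed d => f q.1 * e2pi (-⟪q.1, ν⟫))
      (Measurable.aestronglyMeasurable (by fun_prop))
      (Filter.Eventually.of_forall fun q => by simpa using hM q.1)).congr
      (Filter.Eventually.of_forall fun q => ?_)
    simp only [Function.comp_def, Function.uncurry, Prod.fst_swap, Prod.snd_swap]
    ring
  · rw [integral_mul_const, enorm_mul, enorm_gw, mul_comm]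
    rfl

lemma enorm_STFT_two_le {f : Ed d → ℂ} (hf : Measurable f) {M : ℝ} (hM : ∀ x, ‖f x‖ ≤ M)
    (t ν : Ed d) :
    ‖STFT d (gw 2) f t ν‖ₑ ≤ ENNReal.ofReal (gaussMass d (Real.pi ^ 2))⁻¹ *
      ∫⁻ u, ENNReal.ofReal (gs (Real.pi ^ 2) u) * ‖STFT d (gw 1) f t (ν + u)‖ₑ := by
  have hpi : (0 : ℝ) < Real.pi ^ 2 := by positivity
  have hc := gaussMass_pos d hpi
  have e1 : STFT d (gw 2) f t ν = ((gaussMass d (Real.pi ^ 2))⁻¹ : ℝ) *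
      ∫ y, ∫ u, f y * e2pi (-⟪y, ν⟫) * gw 1 (y - t) *
        (gw (Real.pi ^ 2) u * e2pi ⟪t - y, u⟫) := by
    rw [STFT, ← integral_const_mul]
    refine integral_congr_ae (Filter.Eventually.of_forall fun y => ?_)
    have h := integral_gs_mul_e2pi hpi (t - y)
    rw [div_self hpi.ne'] at h
    simp only [gw] at h ⊢
    rw [integral_const_mul, h, ← neg_sub y t, gs_neg, show (2 : ℝ) = 1 + 1 by norm_num,
      ← gs_mul_gs, Complex.ofReal_inv, Complex.ofReal_mul]
    have hc' : (gaussMass d (Real.pi ^ 2) : ℂ) ≠ 0 := by exact_mod_cast hc.ne'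
    field_simp
  rw [e1, enorm_mul]
  have e2 : ‖(((gaussMass d (Real.pi ^ 2))⁻¹ : ℝ) : ℂ)‖ₑ =
      ENNReal.ofReal (gaussMass d (Real.pi ^ 2))⁻¹ := by
    rw [← ofReal_norm, Complex.norm_real, Real.norm_of_nonneg (by positivity)]
  rw [e2]
  gcongr
  refine (enorm_integral_integral_le ?_).trans (lintegral_mono fun u => ?_)
  · have h1 := ((integrable_gw (d := d) (b := 1) (by norm_num)).comp_sub_right t).mul_prod
      (integrable_gw (d := d) hpi)
    refine (h1.bdd_mul (c := M) (f := fun q : Ed d × Ed d =>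
        f q.1 * e2pi (-⟪q.1, ν⟫) * e2pi ⟪t - q.1, q.2⟫)
      (Measurable.aestronglyMeasurable (by fun_prop))
      (Filter.Eventually.of_forall fun q => by simpa using hM q.1)).congr
      (Filter.Eventually.of_forall fun q => ?_)
    simp only [Function.uncurry]
    ring
  · have e3 : ∀ y, f y * e2pi (-⟪y, ν⟫) * gw 1 (y - t) * (gw (Real.pi ^ 2) u * e2pi ⟪t - y, u⟫) =
        (gw (Real.pi ^ 2) u * e2pi ⟪t, u⟫) * (f y * e2pi (-⟪y, ν + u⟫) * gw 1 (y - t)) := by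
      intro y
      rw [inner_sub_left, sub_eq_add_neg ⟪t, u⟫, inner_add_right, neg_add, e2pi_add, e2pi_add]
      ring
    simp_rw [e3]
    rw [integral_const_mul, enorm_mul, enorm_mul, enorm_gw, enorm_e2pi, mul_one]
    rfl

lemma recNorm_gs_ne_top {b : ℝ} (hb : 0 < b) {θ : ℝ} (hθ : 0 ≤ θ) :
    recNorm (volume : Measure (Ed d)) θ (fun u => ENNReal.ofReal (gs b u)) ≠ ∞ := by
  rcases hθ.eq_or_lt with rfl | hθ
  · rw [recNorm_zero]
    refine ne_top_of_le_ne_top ENNReal.one_ne_top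
      (essSup_le_of_ae_le _ (Filter.Eventually.of_forall fun u => ?_))
    exact ENNReal.ofReal_le_one.2 (gs_le_one hb.le u)
  · rw [recNorm_of_ne hθ.ne']
    have e : ∀ u : Ed d, ENNReal.ofReal (gs b u) ^ (1 / θ) = ENNReal.ofReal (gs (b / θ) u) := by
      intro u
      rw [ENNReal.ofReal_rpow_of_pos (gs_pos b u), gs, gs, ← Real.exp_mul]
      congr 2
      ring
    simp_rw [e]
    rw [lintegral_gs (by positivity)]
    exact ENNReal.rpow_ne_top_of_nonneg hθ.le ENNReal.ofReal_ne_top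

/-- Modulation spaces increase with the exponents. -/
lemma recNorm_recNorm_STFT_le {P P' Q Q' : ℝ} (hP' : 0 ≤ P') (hPP : P' ≤ P) (hP : P ≤ 1)
    (hQ' : 0 ≤ Q') (hQQ : Q' ≤ Q) (hQ : Q ≤ 1) :
    ∃ C : ℝ≥0∞, C ≠ ∞ ∧ ∀ f : Ed d → ℂ, Measurable f → (∃ M : ℝ, ∀ x, ‖f x‖ ≤ M) →
      recNorm volume Q' (fun ν => recNorm volume P' fun t => ‖STFT d (gw 1) f t ν‖ₑ) ≤
        C * recNorm volume Q (fun ν => recNorm volume P fun t => ‖STFT d (gw 1) f t ν‖ₑ) := by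
  have hpi : (0 : ℝ) < Real.pi ^ 2 := by positivity
  have hB := recNorm_gs_ne_top (d := d) (b := 2) (θ := 1 + P' - P) (by norm_num) (by linarith)
  have hG := recNorm_gs_ne_top (d := d) hpi (θ := 1 + Q' - Q) (by linarith)
  refine ⟨ENNReal.ofReal (gaussMass d 4)⁻¹ *
    recNorm volume (1 + P' - P) (fun u : Ed d => ENNReal.ofReal (gs 2 u)) *
    ENNReal.ofReal (gaussMass d (Real.pi ^ 2))⁻¹ *
    recNorm volume (1 + Q' - Q) (fun u : Ed d => ENNReal.ofReal (gs (Real.pi ^ 2) u)),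
    by finiteness, fun f hf ⟨M, hM⟩ => ?_⟩
  exact recNorm_recNorm_le_of_le_conv (V := fun p => ‖STFT d (gw 1) f p.1 p.2‖ₑ)
    (W := fun p => ‖STFT d (gw 2) f p.1 p.2‖ₑ) hP' hPP hP hQ' hQQ hQ (measurable_STFT 1 hf).enorm
    (measurable_STFT 2 hf).enorm (by fun_prop) (by fun_prop) (enorm_STFT_one_le hf hM)
    (enorm_STFT_two_le hf hM)

end ShortTime

section Superposition

variable {X Y V : Type*} [MeasurableSpace X] [MeasurableSpace Y] {μ : Measure X} [SFinite μ]
  {ν : Measure Y} [SFinite ν]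

lemma enorm_integral_mul_integral_le {A : X → ℂ} {N : Y → ℂ} {u : X × Y → ℂ}
    (hA : Integrable A μ) (hN : Integrable N ν) (hu : Measurable u) (hu1 : ∀ q, ‖u q‖ ≤ 1) :
    ‖∫ x, A x * ∫ y, N y * u (x, y) ∂ν ∂μ‖ₑ ≤ ∫⁻ y, ‖N y‖ₑ * ‖∫ x, A x * u (x, y) ∂μ‖ₑ ∂ν := by
  simp_rw [← integral_const_mul]
  refine (enorm_integral_integral_le ?_).trans (lintegral_mono fun y => ?_)
  · refine ((hA.mul_prod hN).bdd_mul (c := 1) hu.aestronglyMeasurable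
      (Filter.Eventually.of_forall hu1)).congr (Filter.Eventually.of_forall fun q => ?_)
    simp only [Function.uncurry]
    ring
  · rw [← enorm_mul, ← integral_const_mul]
    simp_rw [mul_left_comm (N y)]
    rfl

lemma enorm_integral_mul_enorm_integral_le [AddCommGroup V] [MeasurableSpace V]
    [MeasurableAdd₂ V] [MeasurableNeg V] {ν : Measure V} [SFinite ν] [ν.IsAddLeftInvariant]
    {H : X → ℂ} {W : V → ℂ} {p : X → V} (hH : Integrable H μ) (hW : Integrable W ν)
    (hWm : Measurable W) (hp : Measurable p) :
    ‖∫ x, H x ∂μ‖ₑ * ‖∫ v, W v ∂ν‖ₑ ≤ ∫⁻ b, ‖∫ x, H x * W (b - p x) ∂μ‖ₑ ∂ν := by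
  rw [← enorm_mul, ← integral_mul_const]
  refine le_trans (le_of_eq ?_) (enorm_integral_integral_le (integrable_mul_comp_sub hH hW hWm hp))
  simp_rw [integral_const_mul, integral_sub_right_eq_self W]

end Superposition

section Operator

open FourierTransform

variable {d : ℕ}

lemma FT_schwartz_eq (f : SchwartzMap (Ed d) ℂ) : FT d f = ⇑(𝓕 f : SchwartzMap (Ed d) ℂ) := by
  funext ξ
  rw [SchwartzMap.fourier_coe, Real.fourier_eq', FT]
  refine integral_congr_ae (Filter.Eventually.of_forall fun y => ?_)
  simp only [e2pi, smul_eq_mul]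
  rw [mul_comm]
  congr 2
  push_cast
  ring

lemma integrable_FT_schwartz (f : SchwartzMap (Ed d) ℂ) : Integrable (FT d f) := by
  rw [FT_schwartz_eq]
  exact (𝓕 f : SchwartzMap (Ed d) ℂ).integrable

lemma measurable_FT_schwartz (f : SchwartzMap (Ed d) ℂ) : Measurable (FT d f) := by
  rw [FT_schwartz_eq]
  exact (𝓕 f : SchwartzMap (Ed d) ℂ).continuous.measurable

lemma exists_norm_schwartz_le (f : SchwartzMap (Ed d) ℂ) : ∃ M : ℝ, ∀ x, ‖f x‖ ≤ M :=
  ⟨_, SchwartzMap.norm_le_seminorm ℝ f⟩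

variable {σ : Ed d × Ed d × Ed d → ℂ} {f₁ f₂ : Ed d → ℂ}

lemma measurable_biOp (hσ : Measurable σ) (h₁ : Measurable (FT d f₁)) (h₂ : Measurable (FT d f₂)) :
    Measurable (biOp d σ f₁ f₂) := by
  unfold biOp
  refine StronglyMeasurable.measurable (StronglyMeasurable.integral_prod_right'
    (f := fun q : Ed d × (Ed d × Ed d) => e2pi ⟪q.1, q.2.1 + q.2.2⟫ * σ (q.1, q.2.1, q.2.2) *
      FT d f₁ q.2.1 * FT d f₂ q.2.2) ?_)
  refine Measurable.stronglyMeasurable ?_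
  have e1 : Measurable fun q : Ed d × (Ed d × Ed d) => FT d f₁ q.2.1 :=
    h₁.comp (measurable_fst.comp measurable_snd)
  have e2 : Measurable fun q : Ed d × (Ed d × Ed d) => FT d f₂ q.2.2 :=
    h₂.comp (measurable_snd.comp measurable_snd)
  refine (Measurable.mul (by fun_prop) e1).mul e2

lemma exists_norm_biOp_le {M : ℝ} (hM : ∀ X, ‖σ X‖ ≤ M) (h₁ : Integrable (FT d f₁))
    (h₂ : Integrable (FT d f₂)) : ∃ M' : ℝ, ∀ x, ‖biOp d σ f₁ f₂ x‖ ≤ M' := by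
  refine ⟨∫ ξ : Ed d × Ed d, M * ‖FT d f₁ ξ.1 * FT d f₂ ξ.2‖, fun x => ?_⟩
  refine norm_integral_le_of_norm_le ((h₁.mul_prod h₂).norm.const_mul M)
    (Filter.Eventually.of_forall fun ξ => ?_)
  rw [mul_assoc, norm_mul, norm_mul, norm_e2pi, one_mul]
  gcongr
  exact hM _

/-- The kernel of the short-time Fourier transform of `biOp σ` paired with `FT f₁ ⊗ FT f₂`. -/
def opKernel (σ : Ed d × Ed d × Ed d → ℂ) (x ω : Ed d) (X : Ed d × Ed d × Ed d) : ℂ :=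
  σ X * gw 2 (X.1 - x) * (e2pi (-⟪X.1, ω⟫) * e2pi ⟪X.1, X.2.1 + X.2.2⟫)

lemma integrable_opKernel_mul (hσ : Measurable σ) {M : ℝ} (hM : ∀ X, ‖σ X‖ ≤ M) (x ω : Ed d)
    {g₁ g₂ : Ed d → ℂ} (h₁ : Integrable g₁) (h₂ : Integrable g₂) :
    Integrable fun X : Ed d × Ed d × Ed d => opKernel σ x ω X * (g₁ X.2.1 * g₂ X.2.2) := by
  have h := ((integrable_gw (d := d) (b := 2) (by norm_num)).comp_sub_right x).mul_prod
    (h₁.mul_prod h₂)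
  refine (h.bdd_mul (c := M) (f := fun X : Ed d × Ed d × Ed d =>
    σ X * (e2pi (-⟪X.1, ω⟫) * e2pi ⟪X.1, X.2.1 + X.2.2⟫))
    (Measurable.aestronglyMeasurable (by fun_prop))
    (Filter.Eventually.of_forall fun q => by simpa using hM q)).congr
    (Filter.Eventually.of_forall fun q => ?_)
  simp only [opKernel]
  ring

lemma STFT_biOp_eq (hσ : Measurable σ) {M : ℝ} (hM : ∀ X, ‖σ X‖ ≤ M) (h₁ : Integrable (FT d f₁))
    (h₂ : Integrable (FT d f₂)) (x ω : Ed d) :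
    STFT d (gw 2) (biOp d σ f₁ f₂) x ω =
      ∫ X : Ed d × Ed d × Ed d, opKernel σ x ω X * (FT d f₁ X.2.1 * FT d f₂ X.2.2) := by
  have h := integrable_opKernel_mul hσ hM x ω h₁ h₂
  rw [Measure.volume_eq_prod] at h ⊢
  rw [integral_prod _ h, STFT]
  refine integral_congr_ae (Filter.Eventually.of_forall fun y => ?_)
  simp only [biOp, opKernel]
  rw [← integral_mul_const, ← integral_mul_const]
  refine integral_congr_ae (Filter.Eventually.of_forall fun ξ => ?_)
  dsimp only
  ring

/-- Reconstruction of localised Fourier transforms from the short-time Fourier transform. -/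
lemma integral_STFT_mul_e2pi {f : Ed d → ℂ} (hf : Integrable f) (η b : Ed d) :
    ∫ a, STFT d (gw 1) f a b * e2pi (-⟪a, η - b⟫) =
      gaussMass d 1 * (FT d f η * gw (Real.pi ^ 2) (η - b)) := by
  have hi : Integrable (Function.uncurry fun a y : Ed d =>
      f y * e2pi (-⟪y, b⟫) * gw 1 (y - a) * e2pi (-⟪a, η - b⟫)) (volume.prod volume) := by
    have h := (integrable_mul_comp_sub hf (integrable_gw (d := d) (b := 1) (by norm_num))
      (by fun_prop) (p := fun y => y) (by fun_prop)).swap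
    refine (h.bdd_mul (c := 1) (f := fun q : Ed d × Ed d =>
      e2pi (-⟪q.2, b⟫) * e2pi (-⟪q.1, η - b⟫)) (Measurable.aestronglyMeasurable (by fun_prop))
      (Filter.Eventually.of_forall fun q => by simp)).congr
      (Filter.Eventually.of_forall fun q => ?_)
    simp only [Function.comp_def, Function.uncurry, Prod.fst_swap, Prod.snd_swap]
    rw [gw_sub_comm 1 q.1 q.2]
    ring
  simp_rw [STFT, ← integral_mul_const]
  rw [integral_integral_swap hi, FT, ← integral_mul_const, ← integral_const_mul]
  refine integral_congr_ae (Filter.Eventually.of_forall fun y => ?_)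
  have h := integral_gs_mul_e2pi (d := d) one_pos (η - b)
  rw [div_one] at h
  have e1 : ∀ a, f y * e2pi (-⟪y, b⟫) * gw 1 (y - a) * e2pi (-⟪a, η - b⟫) =
      f y * e2pi (-⟪y, η⟫) * (gw 1 (y - a) * e2pi ⟪η - b, y - a⟫) := by
    intro a
    have : e2pi (-⟪y, b⟫) * e2pi (-⟪a, η - b⟫) = e2pi (-⟪y, η⟫) * e2pi ⟪η - b, y - a⟫ := by
      rw [← e2pi_add, ← e2pi_add]
      congr 1
      simp only [inner_sub_right, real_inner_comm y, real_inner_comm a]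
      ring
    linear_combination f y * gw 1 (y - a) * this
  dsimp only
  simp_rw [e1]
  rw [integral_const_mul, integral_sub_left_eq_self (fun a => gw 1 a * e2pi ⟪η - b, a⟫)]
  simp only [gw]
  rw [h]
  ring

lemma integrable_STFT_left {f : Ed d → ℂ} (hf : Integrable f) (b : Ed d) :
    Integrable fun a => STFT d (gw 1) f a b := by
  have h := (integrable_mul_comp_sub hf (integrable_gw (d := d) (b := 1) (by norm_num))
    (by fun_prop) (p := fun y => y) (by fun_prop)).swap
  have h' := h.bdd_mul (c := 1) (f := fun q : Ed d × Ed d => e2pi (-⟪q.2, b⟫))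
    (Measurable.aestronglyMeasurable (by fun_prop)) (Filter.Eventually.of_forall fun q => by simp)
  refine h'.integral_prod_left.congr (Filter.Eventually.of_forall fun a => ?_)
  simp only [STFT, Function.comp_def, Prod.fst_swap, Prod.snd_swap]
  refine integral_congr_ae (Filter.Eventually.of_forall fun y => ?_)
  dsimp only
  rw [gw_sub_comm 1 a y]
  ring

end Operator

section Pointwise

variable {d : ℕ} {σ : Ed d × Ed d × Ed d → ℂ}

/-- The Gaussian density of the superposition of time-frequency shifts in
`enorm_integral_opKernel_le`. -/
def shiftWeight (d : ℕ) (ζ : (Ed d × Ed d) × Ed d × Ed d) : ℂ :=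
  gw (Real.pi ^ 2) ζ.1.1 * gw (1 / 4) ζ.1.2 * (gw (Real.pi ^ 2) ζ.2.1 * gw (1 / 4) ζ.2.2)

lemma integrable_gw_mul_gw : Integrable fun z : Ed d × Ed d =>
    gw (Real.pi ^ 2) z.1 * gw (1 / 4) z.2 :=
  (integrable_gw (by positivity)).mul_prod (integrable_gw (by norm_num))

lemma integrable_shiftWeight : Integrable (shiftWeight d) :=
  integrable_gw_mul_gw.mul_prod integrable_gw_mul_gw

lemma measurable_shiftWeight : Measurable (shiftWeight d) := by
  unfold shiftWeight
  fun_prop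

/-- The mass of the density in `integral_gw_mul_gw_mul_e2pi`. -/
def weylMass (d : ℕ) : ℝ := gaussMass d (1 / 4) * gaussMass d (2 * Real.pi ^ 2)

lemma weylMass_pos (d : ℕ) : 0 < weylMass d :=
  mul_pos (gaussMass_pos d (by norm_num)) (gaussMass_pos d (by positivity))

lemma integral_gw_mul_gw_mul_e2pi (y η : Ed d) :
    ∫ z : Ed d × Ed d, gw (Real.pi ^ 2) z.1 * gw (1 / 4) z.2 *
      e2pi (⟪y, z.1⟫ + ⟪η - (1 / 2 : ℝ) • z.1, z.2⟫) =
    weylMass d * (gw (1 / 2) y * gw (2 * Real.pi ^ 2) η * e2pi ⟪y, η⟫) := by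
  have h := integral_integral_gs_mul_e2pi y η
  have hi : Integrable (fun z : Ed d × Ed d => gw (Real.pi ^ 2) z.1 * gw (1 / 4) z.2 *
      e2pi (⟪y, z.1⟫ + ⟪η - (1 / 2 : ℝ) • z.1, z.2⟫)) (volume.prod volume) :=
    (integrable_gw_mul_gw (d := d)).mul_bdd (c := 1) (Measurable.aestronglyMeasurable (by fun_prop))
      (Filter.Eventually.of_forall fun q => by simp)
  rw [Measure.volume_eq_prod, integral_prod _ hi]
  simp only [gw, weylMass]
  push_cast at h ⊢
  rw [← h]
  refine integral_congr_ae (Filter.Eventually.of_forall fun ν => ?_)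
  dsimp only
  rw [← integral_const_mul]
  refine integral_congr_ae (Filter.Eventually.of_forall fun t => ?_)
  dsimp only
  rw [e2pi_add]
  ring

lemma gauss3_eq (x y z : Ed d) : gauss3 d (x, y, z) = gw 1 x * gw 1 y * gw 1 z := by
  simp only [gauss3, gw, gs]
  rw [← Complex.ofReal_mul, ← Complex.ofReal_mul, ← Real.exp_add, ← Real.exp_add]
  congr 2
  ring

/-- A product of two Weyl-type symbols as a superposition of characters. -/
lemma integral_shiftWeight_mul_e2pi (y η₁ η₂ : Ed d) :
    ∫ ζ, shiftWeight d ζ * e2pi (⟪y, ζ.1.1⟫ + ⟪η₁ - (1 / 2 : ℝ) • ζ.1.1, ζ.1.2⟫ +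
      (⟪y, ζ.2.1⟫ + ⟪η₂ - (1 / 2 : ℝ) • ζ.2.1, ζ.2.2⟫)) =
    weylMass d ^ 2 * (gw (1 / 2) y * gw (2 * Real.pi ^ 2) η₁ * e2pi ⟪y, η₁⟫ *
      (gw (1 / 2) y * gw (2 * Real.pi ^ 2) η₂ * e2pi ⟪y, η₂⟫)) := by
  have h := integral_prod_mul (μ := volume) (ν := volume)
    (fun z : Ed d × Ed d => gw (Real.pi ^ 2) z.1 * gw (1 / 4) z.2 *
      e2pi (⟪y, z.1⟫ + ⟪η₁ - (1 / 2 : ℝ) • z.1, z.2⟫))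
    (fun z : Ed d × Ed d => gw (Real.pi ^ 2) z.1 * gw (1 / 4) z.2 *
      e2pi (⟪y, z.1⟫ + ⟪η₂ - (1 / 2 : ℝ) • z.1, z.2⟫))
  rw [integral_gw_mul_gw_mul_e2pi, integral_gw_mul_gw_mul_e2pi, ← Measure.volume_eq_prod] at h
  rw [show (weylMass d : ℂ) ^ 2 * (gw (1 / 2) y * gw (2 * Real.pi ^ 2) η₁ * e2pi ⟪y, η₁⟫ *
      (gw (1 / 2) y * gw (2 * Real.pi ^ 2) η₂ * e2pi ⟪y, η₂⟫)) =
      weylMass d * (gw (1 / 2) y * gw (2 * Real.pi ^ 2) η₁ * e2pi ⟪y, η₁⟫) *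
      (weylMass d * (gw (1 / 2) y * gw (2 * Real.pi ^ 2) η₂ * e2pi ⟪y, η₂⟫)) by ring, ← h]
  refine integral_congr_ae (Filter.Eventually.of_forall fun ζ => ?_)
  dsimp only
  rw [e2pi_add, shiftWeight]
  ring

lemma integrable_gauss3_mul (hσ : Measurable σ) {M : ℝ} (hM : ∀ X, ‖σ X‖ ≤ M) (x b₁ b₂ : Ed d)
    {φ : Ed d × Ed d × Ed d → ℝ} (hφ : Measurable φ) :
    Integrable fun X : Ed d × Ed d × Ed d =>
      σ X * gauss3 d (X.1 - x, X.2.1 - b₁, X.2.2 - b₂) * e2pi (φ X) := by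
  have hg : Integrable (gw 1 : Ed d → ℂ) := integrable_gw one_pos
  have h := (hg.comp_sub_right x).mul_prod ((hg.comp_sub_right b₁).mul_prod (hg.comp_sub_right b₂))
  refine (h.bdd_mul (c := M) (f := fun X : Ed d × Ed d × Ed d => σ X * e2pi (φ X))
    (Measurable.aestronglyMeasurable (by fun_prop))
    (Filter.Eventually.of_forall fun q => by simpa using hM q)).congr
    (Filter.Eventually.of_forall fun q => ?_)
  simp only [gauss3_eq]
  ring

/-- The remaining window after one factor `gw (π ^ 2)` has been used for reconstruction. -/
def bGauss : ℝ := 1 + 2 * Real.pi ^ 2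

lemma enorm_integral_opKernel_le (hσ : Measurable σ) {M : ℝ} (hM : ∀ X, ‖σ X‖ ≤ M)
    (x ω a₁ a₂ b₁ b₂ : Ed d) :
    ENNReal.ofReal (weylMass d ^ 2) * ‖∫ X : Ed d × Ed d × Ed d,
      opKernel σ x ω X * (gw bGauss (X.2.1 - b₁) * gw bGauss (X.2.2 - b₂)) *
        (e2pi (-⟪a₁, X.2.1 - b₁⟫) * e2pi (-⟪a₂, X.2.2 - b₂⟫))‖ₑ ≤
    ∫⁻ ζ, ‖shiftWeight d ζ‖ₑ * ‖symbSTFT d (gauss3 d) σ x (x - a₁ + ζ.1.2) (x - a₂ + ζ.2.2) b₁ b₂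
      (ω - b₁ - b₂ - (ζ.1.1 + ζ.2.1))‖ₑ := by
  set φ : Ed d × Ed d × Ed d → ℝ := fun X => -⟪X.1, ω⟫ + ⟪X.1, X.2.1 + X.2.2⟫ -
    ⟪X.1 - x, X.2.1 - b₁⟫ - ⟪X.1 - x, X.2.2 - b₂⟫ - ⟪a₁, X.2.1 - b₁⟫ - ⟪a₂, X.2.2 - b₂⟫ with hφ
  have hφm : Measurable φ := by fun_prop
  have h := enorm_integral_mul_integral_le (integrable_gauss3_mul hσ hM x b₁ b₂ hφm)
    integrable_shiftWeight (u := fun q : (Ed d × Ed d × Ed d) × ((Ed d × Ed d) × Ed d × Ed d) =>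
      e2pi (⟪q.1.1 - x, q.2.1.1⟫ + ⟪q.1.2.1 - b₁ - (1 / 2 : ℝ) • q.2.1.1, q.2.1.2⟫ +
      (⟪q.1.1 - x, q.2.2.1⟫ + ⟪q.1.2.2 - b₂ - (1 / 2 : ℝ) • q.2.2.1, q.2.2.2⟫)))
    (by fun_prop) (fun q => by simp)
  have hw : ENNReal.ofReal (weylMass d ^ 2) = ‖((weylMass d : ℂ) ^ 2)‖ₑ := by
    rw [← ofReal_norm, norm_pow, Complex.norm_real, Real.norm_of_nonneg (weylMass_pos d).le]
  rw [hw, ← enorm_mul, ← integral_const_mul]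
  refine le_trans (le_of_eq ?_) (h.trans (lintegral_mono fun ζ => le_of_eq ?_))
  · congr 1
    refine integral_congr_ae (Filter.Eventually.of_forall fun X => ?_)
    dsimp only
    rw [integral_shiftWeight_mul_e2pi, opKernel, gauss3_eq, hφ]
    have e1 : gw 2 (X.1 - x) = gw 1 (X.1 - x) * (gw (1 / 2) (X.1 - x) * gw (1 / 2) (X.1 - x)) := by
      rw [gw_mul_gw, gw_mul_gw]
      norm_num
    have e2 : ∀ w : Ed d, gw bGauss w = gw 1 w * gw (2 * Real.pi ^ 2) w := fun w => by
      rw [gw_mul_gw, bGauss]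
    have e3 : e2pi (-⟪X.1, ω⟫) * e2pi ⟪X.1, X.2.1 + X.2.2⟫ *
        (e2pi (-⟪a₁, X.2.1 - b₁⟫) * e2pi (-⟪a₂, X.2.2 - b₂⟫)) =
        e2pi (φ X) * (e2pi ⟪X.1 - x, X.2.1 - b₁⟫ * e2pi ⟪X.1 - x, X.2.2 - b₂⟫) := by
      simp only [← e2pi_add, hφ]
      congr 1
      ring
    rw [e1, e2, e2]
    linear_combination (weylMass d : ℂ) ^ 2 * σ X *
      (gw 1 (X.1 - x) * (gw (1 / 2) (X.1 - x) * gw (1 / 2) (X.1 - x))) *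
      (gw 1 (X.2.1 - b₁) * gw (2 * Real.pi ^ 2) (X.2.1 - b₁) * (gw 1 (X.2.2 - b₂) *
        gw (2 * Real.pi ^ 2) (X.2.2 - b₂))) * e3
  · congr 1
    set κ : ℝ := -⟪x, b₁⟫ - ⟪x, b₂⟫ + ⟪a₁, b₁⟫ + ⟪a₂, b₂⟫ - ⟪x, ζ.1.1⟫ - ⟪x, ζ.2.1⟫ -
      ⟪b₁ + (1 / 2 : ℝ) • ζ.1.1, ζ.1.2⟫ - ⟪b₂ + (1 / 2 : ℝ) • ζ.2.1, ζ.2.2⟫ with hκ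
    rw [← one_mul ‖symbSTFT _ _ _ _ _ _ _ _ _‖ₑ, ← enorm_e2pi κ, ← enorm_mul, symbSTFT,
      ← integral_const_mul]
    congr 1
    refine integral_congr_ae (Filter.Eventually.of_forall fun X => ?_)
    dsimp only
    rw [mul_left_comm, mul_assoc, ← e2pi_add, ← e2pi_add]
    congr 2
    simp only [hφ, hκ, inner_sub_left, inner_sub_right, inner_add_left, inner_add_right,
      inner_smul_left, real_inner_comm X.2.1 ζ.1.2, real_inner_comm X.2.2 ζ.2.2]
    ring

end Pointwise

section PointwiseBound

variable {d : ℕ} {σ : Ed d × Ed d × Ed d → ℂ} {f₁ f₂ : Ed d → ℂ}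

lemma bGauss_pos : 0 < bGauss := by
  unfold bGauss
  positivity

lemma enorm_integral_opKernel_mul_FT_le (hσ : Measurable σ) {M : ℝ} (hM : ∀ X, ‖σ X‖ ≤ M)
    (h₁ : Integrable f₁) (h₂ : Integrable f₂) (x ω b₁ b₂ : Ed d) :
    ENNReal.ofReal (gaussMass d 1 ^ 2) * ‖∫ X : Ed d × Ed d × Ed d,
      opKernel σ x ω X * (gw bGauss (X.2.1 - b₁) * gw bGauss (X.2.2 - b₂)) *
        (FT d f₁ X.2.1 * gw (Real.pi ^ 2) (X.2.1 - b₁) *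
          (FT d f₂ X.2.2 * gw (Real.pi ^ 2) (X.2.2 - b₂)))‖ₑ ≤
    ∫⁻ a : Ed d × Ed d, ‖STFT d (gw 1) f₁ a.1 b₁‖ₑ * ‖STFT d (gw 1) f₂ a.2 b₂‖ₑ *
      ‖∫ X : Ed d × Ed d × Ed d,
        opKernel σ x ω X * (gw bGauss (X.2.1 - b₁) * gw bGauss (X.2.2 - b₂)) *
          (e2pi (-⟪a.1, X.2.1 - b₁⟫) * e2pi (-⟪a.2, X.2.2 - b₂⟫))‖ₑ := by
  have hg : Integrable (gw bGauss : Ed d → ℂ) := integrable_gw bGauss_pos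
  have h := enorm_integral_mul_integral_le
    (integrable_opKernel_mul hσ hM x ω (hg.comp_sub_right b₁) (hg.comp_sub_right b₂))
    ((integrable_STFT_left h₁ b₁).mul_prod (integrable_STFT_left h₂ b₂))
    (u := fun q : (Ed d × Ed d × Ed d) × Ed d × Ed d =>
      e2pi (-⟪q.2.1, q.1.2.1 - b₁⟫) * e2pi (-⟪q.2.2, q.1.2.2 - b₂⟫))
    (by fun_prop) (fun q => by simp)
  have hw : ENNReal.ofReal (gaussMass d 1 ^ 2) = ‖((gaussMass d 1 : ℂ) ^ 2)‖ₑ := by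
    rw [← ofReal_norm, norm_pow, Complex.norm_real,
      Real.norm_of_nonneg (gaussMass_pos d one_pos).le]
  simp_rw [← enorm_mul]
  rw [hw, ← enorm_mul, ← integral_const_mul]
  simp_rw [← enorm_mul] at h
  refine le_trans (le_of_eq ?_) h
  congr 1
  refine integral_congr_ae (Filter.Eventually.of_forall fun X => ?_)
  dsimp only
  have e := integral_prod_mul (μ := (volume : Measure (Ed d))) (ν := (volume : Measure (Ed d)))
    (fun a => STFT d (gw 1) f₁ a b₁ * e2pi (-⟪a, X.2.1 - b₁⟫))
    (fun a => STFT d (gw 1) f₂ a b₂ * e2pi (-⟪a, X.2.2 - b₂⟫))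
  rw [integral_STFT_mul_e2pi h₁, integral_STFT_mul_e2pi h₂] at e
  simp_rw [fun a : Ed d × Ed d => mul_mul_mul_comm (STFT d (gw 1) f₁ a.1 b₁)
    (e2pi (-⟪a.1, X.2.1 - b₁⟫))] at e
  rw [e]
  ring

/-- The constant in the pointwise bound `enorm_STFT_biOp_le`. -/
def ptConst (d : ℕ) : ℝ :=
  weylMass d ^ 2 * (gaussMass d 1 ^ 2 * gaussMass d (bGauss + Real.pi ^ 2) ^ 2)

lemma ptConst_pos (d : ℕ) : 0 < ptConst d :=
  mul_pos (pow_pos (weylMass_pos d) 2) (mul_pos (pow_pos (gaussMass_pos d one_pos) 2)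
    (pow_pos (gaussMass_pos d (by have := bGauss_pos; positivity)) 2))

lemma enorm_STFT_biOp_le (hσ : Measurable σ) {M : ℝ} (hM : ∀ X, ‖σ X‖ ≤ M)
    (h₁ : Integrable f₁) (h₂ : Integrable f₂) (h₁' : Integrable (FT d f₁))
    (h₂' : Integrable (FT d f₂)) (x ω : Ed d) :
    ENNReal.ofReal (ptConst d) * ‖STFT d (gw 2) (biOp d σ f₁ f₂) x ω‖ₑ ≤
    ∫⁻ b : Ed d × Ed d, ∫⁻ a : Ed d × Ed d,
      ‖STFT d (gw 1) f₁ a.1 b.1‖ₑ * ‖STFT d (gw 1) f₂ a.2 b.2‖ₑ *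
        ∫⁻ ζ, ‖shiftWeight d ζ‖ₑ * ‖symbSTFT d (gauss3 d) σ (x) (x - a.1 + ζ.1.2)
          (x - a.2 + ζ.2.2) b.1 b.2 (ω - b.1 - b.2 - (ζ.1.1 + ζ.2.1))‖ₑ := by
  have hR : 0 < bGauss + Real.pi ^ 2 := by
    have := bGauss_pos
    positivity
  have hgR : Integrable (gw (bGauss + Real.pi ^ 2) : Ed d → ℂ) := integrable_gw hR
  have h := enorm_integral_mul_enorm_integral_le (integrable_opKernel_mul hσ hM x ω h₁' h₂')
    (hgR.mul_prod hgR) (by fun_prop) (p := fun X : Ed d × Ed d × Ed d => X.2) measurable_snd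
  have e0 : ∫ w : Ed d, gw (bGauss + Real.pi ^ 2) w = gaussMass d (bGauss + Real.pi ^ 2) := by
    simp only [gw]
    rw [integral_complex_ofReal, integral_gs hR]
  have e1 : ‖∫ z : Ed d × Ed d, gw (bGauss + Real.pi ^ 2) z.1 * gw (bGauss + Real.pi ^ 2) z.2
      ∂(volume.prod volume)‖ₑ = ENNReal.ofReal (gaussMass d (bGauss + Real.pi ^ 2) ^ 2) := by
    rw [integral_prod_mul, e0, ← sq, ← ofReal_norm, norm_pow, Complex.norm_real,
      Real.norm_of_nonneg (gaussMass_pos d hR).le]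
  rw [e1, ← STFT_biOp_eq hσ hM h₁' h₂'] at h
  have hc : ENNReal.ofReal (ptConst d) = ENNReal.ofReal (weylMass d ^ 2) *
      (ENNReal.ofReal (gaussMass d 1 ^ 2) *
        ENNReal.ofReal (gaussMass d (bGauss + Real.pi ^ 2) ^ 2)) := by
    rw [← ENNReal.ofReal_mul (by positivity), ← ENNReal.ofReal_mul (by positivity), ptConst]
  rw [hc, mul_assoc, mul_assoc, mul_comm (ENNReal.ofReal (gaussMass d (_ + _) ^ 2))]
  refine (mul_le_mul_right (mul_le_mul_right h _) _).trans ?_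
  rw [← lintegral_const_mul' _ _ ENNReal.ofReal_ne_top,
    ← lintegral_const_mul' _ _ ENNReal.ofReal_ne_top]
  refine lintegral_mono fun b => ?_
  have h2 := enorm_integral_opKernel_mul_FT_le hσ hM h₁ h₂ x ω b.1 b.2
  have e2 : ∀ X : Ed d × Ed d × Ed d, opKernel σ x ω X * (FT d f₁ X.2.1 * FT d f₂ X.2.2) *
      (gw (bGauss + Real.pi ^ 2) (b - X.2).1 * gw (bGauss + Real.pi ^ 2) (b - X.2).2) =
      opKernel σ x ω X * (gw bGauss (X.2.1 - b.1) * gw bGauss (X.2.2 - b.2)) *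
        (FT d f₁ X.2.1 * gw (Real.pi ^ 2) (X.2.1 - b.1) *
          (FT d f₂ X.2.2 * gw (Real.pi ^ 2) (X.2.2 - b.2))) := fun X => by
    rw [Prod.fst_sub, Prod.snd_sub, gw_sub_comm _ b.1, gw_sub_comm _ b.2, ← gw_mul_gw, ← gw_mul_gw]
    ring
  simp_rw [e2]
  refine (mul_le_mul_right h2 _).trans ?_
  rw [← lintegral_const_mul' _ _ ENNReal.ofReal_ne_top]
  refine lintegral_mono fun a => ?_
  dsimp only
  rw [mul_left_comm]
  exact mul_le_mul_right (enorm_integral_opKernel_le hσ hM x ω a.1 a.2 b.1 b.2) _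

lemma measurable_symbSTFT (hσ : Measurable σ) :
    Measurable fun q : Ed d × Ed d × Ed d × Ed d × Ed d × Ed d =>
      symbSTFT d (gauss3 d) σ q.1 q.2.1 q.2.2.1 q.2.2.2.1 q.2.2.2.2.1 q.2.2.2.2.2 := by
  unfold symbSTFT
  simp only [gauss3_eq]
  refine StronglyMeasurable.measurable (StronglyMeasurable.integral_prod_right'
    (f := fun q : (Ed d × Ed d × Ed d × Ed d × Ed d × Ed d) × (Ed d × Ed d × Ed d) =>
      σ q.2 * (gw 1 (q.2.1 - q.1.1) * gw 1 (q.2.2.1 - q.1.2.2.2.1) *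
        gw 1 (q.2.2.2 - q.1.2.2.2.2.1)) * e2pi (-(⟪q.2.1, q.1.2.2.2.2.2⟫ -
          ⟪q.1.2.1, q.2.2.1⟫ - ⟪q.1.2.2.1, q.2.2.2⟫))) ?_)
  exact Measurable.stronglyMeasurable (by fun_prop)

end PointwiseBound

section Assembly

variable {E : Type*} [AddCommGroup E] [MeasurableSpace E] [MeasurableAdd₂ E] [MeasurableNeg E]
  {μ : Measure E} [SigmaFinite μ] [μ.IsAddLeftInvariant]

/-- The mixed-norm estimate of `recNorm_time_le` for given reciprocal exponents. -/
def TimeEstimate (μ : Measure E) (r₀ r₁ r₂ P₀ P₁ P₂ : ℝ) : Prop :=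
  ∀ (S : E × E × E → ℝ≥0∞) (F₁ F₂ : E → ℝ≥0∞), Measurable S → Measurable F₁ → Measurable F₂ →
    recNorm μ P₀ (fun x => ∫⁻ t₂, ∫⁻ t₁, S (x, t₁, t₂) * (F₁ (x - t₁) * F₂ (x - t₂)) ∂μ ∂μ) ≤
      recNorm μ r₂ (fun t₂ => recNorm μ r₁ fun t₁ => recNorm μ r₀ fun x => S (x, t₁, t₂)) *
        (recNorm μ P₁ F₁ * recNorm μ P₂ F₂)

/-- The mixed-norm estimate of `recNorm_freq_le` for given reciprocal exponents. -/
def FreqEstimate (μ : Measure E) (s₁ s₂ s₃ Q₁ Q₂ Q₃ : ℝ) : Prop :=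
  ∀ (S : E × E × E → ℝ≥0∞) (F₁ F₂ : E → ℝ≥0∞), Measurable S → Measurable F₁ → Measurable F₂ →
    recNorm μ Q₃ (fun ω => ∫⁻ ξ₂, ∫⁻ ξ₁, S (ξ₁, ξ₂, ω - ξ₁ - ξ₂) * (F₁ ξ₁ * F₂ ξ₂) ∂μ ∂μ) ≤
      recNorm μ s₃ (fun ν => recNorm μ s₂ fun ξ₂ => recNorm μ s₁ fun ξ₁ => S (ξ₁, ξ₂, ν)) *
        (recNorm μ Q₁ F₁ * recNorm μ Q₂ F₂)

lemma lintegral_prod_sub_add [μ.IsNegInvariant] {T : E × E → ℝ≥0∞} (hT : Measurable T)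
    {F₁ F₂ : E → ℝ≥0∞} (hF₁ : Measurable F₁) (hF₂ : Measurable F₂) (x τ₁ τ₂ : E) :
    ∫⁻ a : E × E, F₁ a.1 * F₂ a.2 * T (x - a.1 + τ₁, x - a.2 + τ₂) ∂μ.prod μ =
      ∫⁻ t₂, ∫⁻ t₁, T (t₁, t₂) * (F₁ (x - t₁ + τ₁) * F₂ (x - t₂ + τ₂)) ∂μ ∂μ := by
  have e : ∀ t τ : E, x - (x + τ - t) + τ = t := fun t τ => by abel
  have e' : ∀ t τ : E, x + τ - t = x - t + τ := fun t τ => by abel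
  rw [lintegral_prod_symm' _ (by simp_rw [sub_eq_add_neg]; fun_prop),
    ← lintegral_sub_left_eq_self _ (x + τ₂)]
  refine lintegral_congr fun t₂ => ?_
  rw [← lintegral_sub_left_eq_self _ (x + τ₁)]
  refine lintegral_congr fun t₁ => ?_
  dsimp only
  rw [e, e, e', e', mul_comm]

lemma TimeEstimate.shift [μ.IsNegInvariant] {r₀ r₁ r₂ P₀ P₁ P₂ : ℝ}
    (h : TimeEstimate μ r₀ r₁ r₂ P₀ P₁ P₂) {S : E × E × E → ℝ≥0∞} (hS : Measurable S) {F₁ F₂ : E → ℝ≥0∞}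
    (hF₁ : Measurable F₁) (hF₂ : Measurable F₂) (τ₁ τ₂ : E) :
    recNorm μ P₀ (fun x => ∫⁻ a : E × E, F₁ a.1 * F₂ a.2 *
        S (x, x - a.1 + τ₁, x - a.2 + τ₂) ∂μ.prod μ) ≤
      recNorm μ r₂ (fun t₂ => recNorm μ r₁ fun t₁ => recNorm μ r₀ fun x => S (x, t₁, t₂)) *
        (recNorm μ P₁ F₁ * recNorm μ P₂ F₂) := by
  have e : ∀ x, ∫⁻ a : E × E, F₁ a.1 * F₂ a.2 * S (x, x - a.1 + τ₁, x - a.2 + τ₂) ∂μ.prod μ =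
      ∫⁻ t₂, ∫⁻ t₁, S (x, t₁, t₂) * (F₁ (x - t₁ + τ₁) * F₂ (x - t₂ + τ₂)) ∂μ ∂μ := fun x =>
    lintegral_prod_sub_add (T := fun p => S (x, p)) (by fun_prop) hF₁ hF₂ x τ₁ τ₂
  simp_rw [e]
  refine (h S (fun u => F₁ (u + τ₁)) (fun u => F₂ (u + τ₂)) hS (by fun_prop)
    (by fun_prop)).trans (le_of_eq ?_)
  rw [recNorm_map (measurePreserving_add_right μ τ₁) hF₁,
    recNorm_map (measurePreserving_add_right μ τ₂) hF₂]

lemma FreqEstimate.shift {s₁ s₂ s₃ Q₁ Q₂ Q₃ : ℝ} (h : FreqEstimate μ s₁ s₂ s₃ Q₁ Q₂ Q₃)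
    {S : E × E × E → ℝ≥0∞} (hS : Measurable S) {F₁ F₂ : E → ℝ≥0∞}
    (hF₁ : Measurable F₁) (hF₂ : Measurable F₂) (ν : E) :
    recNorm μ Q₃ (fun ω => ∫⁻ b : E × E, S (b.1, b.2, ω - b.1 - b.2 - ν) *
        (F₁ b.1 * F₂ b.2) ∂μ.prod μ) ≤
      recNorm μ s₃ (fun ν => recNorm μ s₂ fun ξ₂ => recNorm μ s₁ fun ξ₁ => S (ξ₁, ξ₂, ν)) *
        (recNorm μ Q₁ F₁ * recNorm μ Q₂ F₂) := by
  refine le_trans (le_of_eq ?_) (h S F₁ F₂ hS hF₁ hF₂)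
  have m : Measurable fun ω => ∫⁻ ξ₂, ∫⁻ ξ₁, S (ξ₁, ξ₂, ω - ξ₁ - ξ₂) * (F₁ ξ₁ * F₂ ξ₂) ∂μ ∂μ := by
    refine Measurable.lintegral_prod_right' (f := fun p : E × E =>
      ∫⁻ ξ₁, S (ξ₁, p.2, p.1 - ξ₁ - p.2) * (F₁ ξ₁ * F₂ p.2) ∂μ) ?_
    refine Measurable.lintegral_prod_right' (f := fun p : (E × E) × E =>
      S (p.2, p.1.2, p.1.1 - p.2 - p.1.2) * (F₁ p.2 * F₂ p.1.2)) ?_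
    simp_rw [sub_eq_add_neg]
    fun_prop
  rw [← recNorm_map (measurePreserving_add_right μ (-ν)) m]
  congr 1
  funext ω
  rw [lintegral_prod_symm' _ (by simp_rw [sub_eq_add_neg]; fun_prop)]
  refine lintegral_congr fun ξ₂ => lintegral_congr fun ξ₁ => ?_
  rw [show ω - ξ₁ - ξ₂ - ν = ω + -ν - ξ₁ - ξ₂ by abel]

variable {Z : Type*} [MeasurableSpace Z] {ρ : Measure Z} [SFinite ρ]

/-- The mixed-norm bound for superpositions of shifted bilinear pairings. -/
lemma recNorm_recNorm_superposition_le [μ.IsNegInvariant] {r₀ r₁ r₂ P₀ P₁ P₂ s₁ s₂ s₃ Q₁ Q₂ Q₃ : ℝ}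
    (hP₀ : 0 ≤ P₀) (hP₀1 : P₀ ≤ 1) (hQ₃ : 0 ≤ Q₃) (hQ₃1 : Q₃ ≤ 1)
    (hT : TimeEstimate μ r₀ r₁ r₂ P₀ P₁ P₂) (hF : FreqEstimate μ s₁ s₂ s₃ Q₁ Q₂ Q₃)
    {S : (E × E × E) × E × E × E → ℝ≥0∞} (hS : Measurable S) {A₁ A₂ : E × E → ℝ≥0∞}
    (hA₁ : Measurable A₁) (hA₂ : Measurable A₂) {N : Z → ℝ≥0∞} (hN : Measurable N)
    {τ₁ τ₂ ν : Z → E} (hτ₁ : Measurable τ₁) (hτ₂ : Measurable τ₂) (hν : Measurable ν) :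
    recNorm μ Q₃ (fun ω => recNorm μ P₀ fun x => ∫⁻ b : E × E, ∫⁻ a : E × E,
      A₁ (a.1, b.1) * A₂ (a.2, b.2) * ∫⁻ z, N z * S ((x, x - a.1 + τ₁ z, x - a.2 + τ₂ z),
        b.1, b.2, ω - b.1 - b.2 - ν z) ∂ρ ∂μ.prod μ ∂μ.prod μ) ≤
    (∫⁻ z, N z ∂ρ) * (recNorm μ s₃ (fun ν => recNorm μ s₂ fun ξ₂ => recNorm μ s₁ fun ξ₁ =>
      recNorm μ r₂ fun t₂ => recNorm μ r₁ fun t₁ => recNorm μ r₀ fun x =>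
        S ((x, t₁, t₂), ξ₁, ξ₂, ν)) *
      (recNorm μ Q₁ (fun b => recNorm μ P₁ fun a => A₁ (a, b)) *
        recNorm μ Q₂ (fun b => recNorm μ P₂ fun a => A₂ (a, b)))) := by
  set S' : E × E × E → ℝ≥0∞ := fun Y => recNorm μ r₂ fun t₂ => recNorm μ r₁ fun t₁ =>
    recNorm μ r₀ fun x => S ((x, t₁, t₂), Y) with hS'
  set α₁ : E → ℝ≥0∞ := fun b => recNorm μ P₁ fun a => A₁ (a, b) with hα₁
  set α₂ : E → ℝ≥0∞ := fun b => recNorm μ P₂ fun a => A₂ (a, b) with hα₂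
  have mα₁ : Measurable α₁ := measurable_recNorm_prod (F := fun p : E × E => A₁ (p.2, p.1)) P₁
    (by fun_prop)
  have mα₂ : Measurable α₂ := measurable_recNorm_prod (F := fun p : E × E => A₂ (p.2, p.1)) P₂
    (by fun_prop)
  have mS' : Measurable S' := by
    refine measurable_recNorm_prod (F := fun p : (E × E × E) × E => recNorm μ r₁ fun t₁ =>
      recNorm μ r₀ fun x => S ((x, t₁, p.2), p.1)) r₂ ?_
    refine measurable_recNorm_prod (F := fun p : ((E × E × E) × E) × E =>
      recNorm μ r₀ fun x => S ((x, p.2, p.1.2), p.1.1)) r₁ ?_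
    refine measurable_recNorm_prod (F := fun p : (((E × E × E) × E) × E) × E =>
      S ((p.2, p.1.2, p.1.1.2), p.1.1.1)) r₀ ?_
    fun_prop
  set K : E → E → E × E → Z → ℝ≥0∞ := fun ω x b z => ∫⁻ a : E × E, A₁ (a.1, b.1) * A₂ (a.2, b.2) *
    S ((x, x - a.1 + τ₁ z, x - a.2 + τ₂ z), b.1, b.2, ω - b.1 - b.2 - ν z) ∂μ.prod μ with hK
  have mK : Measurable fun p : (E × E) × (E × E) × Z => K p.1.1 p.1.2 p.2.1 p.2.2 := by
    refine Measurable.lintegral_prod_right' (f := fun p : ((E × E) × (E × E) × Z) × E × E =>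
      A₁ (p.2.1, p.1.2.1.1) * A₂ (p.2.2, p.1.2.1.2) * S ((p.1.1.2, p.1.1.2 - p.2.1 + τ₁ p.1.2.2,
        p.1.1.2 - p.2.2 + τ₂ p.1.2.2), p.1.2.1.1, p.1.2.1.2,
        p.1.1.1 - p.1.2.1.1 - p.1.2.1.2 - ν p.1.2.2)) ?_
    simp_rw [sub_eq_add_neg]
    fun_prop
  have eK : ∀ ω x, ∫⁻ b : E × E, ∫⁻ a : E × E,
      A₁ (a.1, b.1) * A₂ (a.2, b.2) * ∫⁻ z, N z * S ((x, x - a.1 + τ₁ z, x - a.2 + τ₂ z),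
        b.1, b.2, ω - b.1 - b.2 - ν z) ∂ρ ∂μ.prod μ ∂μ.prod μ =
      ∫⁻ q : Z × E × E, N q.1 * K ω x q.2 q.1 ∂ρ.prod (μ.prod μ) := by
    intro ω x
    have m1 : Measurable fun q : Z × E × E => N q.1 * K ω x q.2 q.1 :=
      (hN.comp measurable_fst).mul (mK.comp (f := fun q : Z × E × E => ((ω, x), q.2, q.1))
        (by fun_prop) :)
    rw [lintegral_prod_symm' _ m1]
    refine lintegral_congr fun b => ?_
    have m2 : Measurable fun p : (E × E) × Z => N p.2 * S ((x, x - p.1.1 + τ₁ p.2,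
        x - p.1.2 + τ₂ p.2), b.1, b.2, ω - b.1 - b.2 - ν p.2) := by
      simp_rw [sub_eq_add_neg]
      fun_prop
    have m3 : Measurable fun a : E × E => A₁ (a.1, b.1) * A₂ (a.2, b.2) := by fun_prop
    have e1 : ∀ a : E × E, A₁ (a.1, b.1) * A₂ (a.2, b.2) * ∫⁻ z, N z * S ((x, x - a.1 + τ₁ z,
        x - a.2 + τ₂ z), b.1, b.2, ω - b.1 - b.2 - ν z) ∂ρ =
        ∫⁻ z, A₁ (a.1, b.1) * A₂ (a.2, b.2) * (N z * S ((x, x - a.1 + τ₁ z,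
          x - a.2 + τ₂ z), b.1, b.2, ω - b.1 - b.2 - ν z)) ∂ρ := fun a =>
      (lintegral_const_mul _ (m2.comp measurable_prodMk_left :)).symm
    simp_rw [e1]
    rw [lintegral_lintegral_swap ((m3.comp measurable_fst).mul m2).aemeasurable]
    refine lintegral_congr fun z => ?_
    rw [hK, ← lintegral_const_mul]
    · refine lintegral_congr fun a => ?_
      ring
    · simp_rw [sub_eq_add_neg]
      fun_prop
  have b1 : ∀ ω, recNorm μ P₀ (fun x => ∫⁻ q : Z × E × E, N q.1 * K ω x q.2 q.1
      ∂ρ.prod (μ.prod μ)) ≤ ∫⁻ z, N z * ∫⁻ b : E × E,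
        S' (b.1, b.2, ω - b.1 - b.2 - ν z) * (α₁ b.1 * α₂ b.2) ∂μ.prod μ ∂ρ := by
    intro ω
    refine (recNorm_lintegral_le hP₀ hP₀1 (F := fun x (q : Z × E × E) => N q.1 * K ω x q.2 q.1)
      ?_).trans ?_
    · exact (hN.comp (measurable_fst.comp measurable_snd)).mul
        (mK.comp (f := fun p : E × Z × E × E => ((ω, p.1), p.2.2, p.2.1)) (by fun_prop) :)
    have m4 : Measurable fun q : Z × E × E => N q.1 *
        (S' (q.2.1, q.2.2, ω - q.2.1 - q.2.2 - ν q.1) * (α₁ q.2.1 * α₂ q.2.2)) := by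
      simp_rw [sub_eq_add_neg]
      fun_prop
    calc ∫⁻ q : Z × E × E, recNorm μ P₀ (fun x => N q.1 * K ω x q.2 q.1) ∂ρ.prod (μ.prod μ)
        ≤ ∫⁻ q : Z × E × E, N q.1 *
          (S' (q.2.1, q.2.2, ω - q.2.1 - q.2.2 - ν q.1) * (α₁ q.2.1 * α₂ q.2.2))
            ∂ρ.prod (μ.prod μ) := by
          refine lintegral_mono fun q => ?_
          have m5 : Measurable fun x => K ω x q.2 q.1 :=
            (mK.comp (f := fun x : E => ((ω, x), q.2, q.1)) (by fun_prop) :)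
          dsimp only
          rw [recNorm_const_mul hP₀ _ m5]
          refine mul_le_mul_right ?_ _
          exact hT.shift (S := fun X => S (X, q.2.1, q.2.2, ω - q.2.1 - q.2.2 - ν q.1))
            (by fun_prop) (F₁ := fun a => A₁ (a, q.2.1)) (by fun_prop)
            (F₂ := fun a => A₂ (a, q.2.2)) (by fun_prop) (τ₁ q.1) (τ₂ q.1)
      _ = ∫⁻ z, N z * ∫⁻ b : E × E,
          S' (b.1, b.2, ω - b.1 - b.2 - ν z) * (α₁ b.1 * α₂ b.2) ∂μ.prod μ ∂ρ := by
          rw [lintegral_prod _ m4.aemeasurable]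
          refine lintegral_congr fun z => ?_
          dsimp only
          rw [lintegral_const_mul]
          simp_rw [sub_eq_add_neg]
          fun_prop
  simp_rw [eK]
  refine (recNorm_mono hQ₃ b1).trans ?_
  have m6 : Measurable fun p : E × Z => ∫⁻ b : E × E,
      S' (b.1, b.2, p.1 - b.1 - b.2 - ν p.2) * (α₁ b.1 * α₂ b.2) ∂μ.prod μ := by
    refine Measurable.lintegral_prod_right' (f := fun q : (E × Z) × E × E =>
      S' (q.2.1, q.2.2, q.1.1 - q.2.1 - q.2.2 - ν q.1.2) * (α₁ q.2.1 * α₂ q.2.2)) ?_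
    simp_rw [sub_eq_add_neg]
    fun_prop
  refine (recNorm_lintegral_le hQ₃ hQ₃1 (F := fun ω z => N z * ∫⁻ b : E × E,
      S' (b.1, b.2, ω - b.1 - b.2 - ν z) * (α₁ b.1 * α₂ b.2) ∂μ.prod μ)
    ((hN.comp measurable_snd).mul m6)).trans ?_
  rw [← lintegral_mul_const _ hN]
  refine lintegral_mono fun z => ?_
  dsimp only
  have m7 : Measurable fun ω => ∫⁻ b : E × E, S' (b.1, b.2, ω - b.1 - b.2 - ν z) *
      (α₁ b.1 * α₂ b.2) ∂μ.prod μ := (m6.comp (f := fun ω : E => (ω, z)) (by fun_prop) :)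
  rw [recNorm_const_mul hQ₃ _ m7]
  exact mul_le_mul_right (hF.shift mS' mα₁ mα₂ (ν z)) _

end Assembly

section Exponents

variable {d : ℕ}

lemma exists_timeEstimate {p₀ p₁ p₂ r₀ r₁ r₂ : ℝ} (hp₀ : 0 ≤ p₀)
    (hr₀ : 0 ≤ r₀) (hr₀1 : r₀ ≤ 1) (hr₁1 : r₁ ≤ 1) (hr₂1 : r₂ ≤ 1)
    (t₁ : 1 ≤ p₁ + r₁) (t₂ : 1 ≤ p₂ + r₂) (t₃ : p₀ ≤ r₂) (t₄ : r₀ ≤ r₁) (t₅ : r₀ ≤ r₂)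
    (t₆ : 2 + p₀ ≤ r₀ + r₁ + r₂ + min p₁ (1 - r₀) + p₂) :
    ∃ P₀ P₁ P₂ : ℝ, p₀ ≤ P₀ ∧ P₀ ≤ 1 ∧ 0 ≤ P₁ ∧ P₁ ≤ p₁ ∧ 0 ≤ P₂ ∧ P₂ ≤ p₂ ∧
      TimeEstimate (volume : Measure (Ed d)) r₀ r₁ r₂ P₀ P₁ P₂ := by
  obtain ⟨m, hm⟩ : ∃ m, m = min p₁ (1 - r₀) := ⟨_, rfl⟩
  obtain ⟨n, hn⟩ : ∃ n, n = min (r₀ + r₁ + m - 1) r₂ := ⟨_, rfl⟩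
  obtain ⟨P₂, hP₂⟩ : ∃ P₂, P₂ = min p₂ (1 - n) := ⟨_, rfl⟩
  rw [← hm] at t₆
  have hm1 : m ≤ p₁ := hm ▸ min_le_left _ _
  have hm2 : m ≤ 1 - r₀ := hm ▸ min_le_right _ _
  have hm3 : 1 - r₁ ≤ m := hm ▸ le_min (by linarith) (by linarith)
  have hm4 : 0 ≤ m := by linarith
  have hn1 : n ≤ r₀ + r₁ + m - 1 := hn ▸ min_le_left _ _
  have hn2 : n ≤ r₂ := hn ▸ min_le_right _ _
  have hn3 : r₀ ≤ n := hn ▸ le_min (by linarith) t₅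
  have hP1 : P₂ ≤ p₂ := hP₂ ▸ min_le_left _ _
  have hP2 : P₂ ≤ 1 - n := hP₂ ▸ min_le_right _ _
  have hP3 : 1 - r₂ ≤ P₂ := hP₂ ▸ le_min (by linarith) (by linarith)
  have hP4 : p₀ + 1 - n - r₂ ≤ P₂ := by
    rw [hP₂]
    refine le_min ?_ (by linarith)
    have : p₀ + 1 - r₂ - p₂ ≤ n := hn ▸ le_min (by linarith) (by linarith)
    linarith
  refine ⟨P₂ - (1 - n) + r₂, 2 - r₀ - r₁ - (1 - n), P₂, by linarith, by linarith, by linarith,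
    by linarith, by linarith, hP1, fun S F₁ F₂ hS hF₁ hF₂ => ?_⟩
  exact recNorm_time_le (a := 1 - n) hr₀ hr₀1 (by linarith) hr₁1 (by linarith) hr₂1 (by linarith)
    (by linarith) (by linarith) (by linarith) (by linarith) (by linarith) (by linarith)
    (by linarith) hP2 (by linarith) (by linarith) hS hF₁ hF₂

lemma exists_freqEstimate {q₁ q₂ q₃ s₁ s₂ s₃ : ℝ} (hq₃ : 0 ≤ q₃)
    (hq₃1 : q₃ ≤ 1) (hs₁ : 0 ≤ s₁) (hs₁1 : s₁ ≤ 1) (hs₂ : 0 ≤ s₂) (hs₂1 : s₂ ≤ 1) (hs₃1 : s₃ ≤ 1)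
    (u₁ : 1 - q₂ ≤ s₃) (u₂ : s₂ ≤ s₃)
    (u₃ : 2 ≤ min q₁ (1 - s₁) + min q₂ (1 - s₂) + s₂ + s₃)
    (u₄ : 2 + q₃ ≤ min q₁ (1 - s₁) + min q₂ (1 - s₂) + s₁ + s₂ + s₃) :
    ∃ Q₁ Q₂ Q₃ : ℝ, q₃ ≤ Q₃ ∧ Q₃ ≤ 1 ∧ 0 ≤ Q₁ ∧ Q₁ ≤ q₁ ∧ 0 ≤ Q₂ ∧ Q₂ ≤ q₂ ∧
      FreqEstimate (volume : Measure (Ed d)) s₁ s₂ s₃ Q₁ Q₂ Q₃ := by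
  obtain ⟨m, hm⟩ : ∃ m, m = min q₁ (1 - s₁) := ⟨_, rfl⟩
  obtain ⟨Q₂, hQ₂⟩ : ∃ Q₂, Q₂ = min q₂ (1 - s₂) := ⟨_, rfl⟩
  obtain ⟨w, hw⟩ : ∃ w, w = min (1 - q₃) (1 - s₁) := ⟨_, rfl⟩
  rw [← hm, ← hQ₂] at u₃ u₄
  have hm1 : m ≤ q₁ := hm ▸ min_le_left _ _
  have hm2 : m ≤ 1 - s₁ := hm ▸ min_le_right _ _
  have hQ1 : Q₂ ≤ q₂ := hQ₂ ▸ min_le_left _ _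
  have hQ2 : Q₂ ≤ 1 - s₂ := hQ₂ ▸ min_le_right _ _
  have hQ3 : 1 - s₃ ≤ Q₂ := hQ₂ ▸ le_min (by linarith) (by linarith)
  have hw1 : w ≤ 1 - q₃ := hw ▸ min_le_left _ _
  have hw2 : w ≤ 1 - s₁ := hw ▸ min_le_right _ _
  have hw3 : 0 ≤ w := hw ▸ le_min (by linarith) (by linarith)
  have hw4 : 2 - s₂ - s₃ - Q₂ ≤ w := hw ▸ le_min (by linarith) (by linarith)
  have hw5 : 1 - s₁ + (2 - s₂ - s₃ - Q₂) - m ≤ w := hw ▸ le_min (by linarith) (by linarith)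
  refine ⟨1 - s₁ + (2 - s₂ - s₃ - Q₂) - w, Q₂, 1 - w, by linarith, by linarith, by linarith,
    by linarith, by linarith, hQ1, fun S F₁ F₂ hS hF₁ hF₂ => ?_⟩
  exact recNorm_freq_le (a := 2 - s₂ - s₃ - Q₂) hs₁ hs₁1 hs₂ hs₂1 (by linarith) hs₃1 (by linarith)
    (by linarith) (by linarith) (by linarith) (by linarith) (by linarith) (by linarith)
    (by linarith) hQ2 (by linarith) (by linarith) hS hF₁ hF₂

end Exponents

section Boundedness

variable {d : ℕ}

/-- The mixed norm of the symbol short-time Fourier transform in reciprocal exponents. -/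
def symbRecNorm (d : ℕ) (r₀ r₁ r₂ s₁ s₂ s₃ : ℝ) (σ : Ed d × Ed d × Ed d → ℂ) : ℝ≥0∞ :=
  recNorm volume s₃ fun ν => recNorm volume s₂ fun ξ₂ => recNorm volume s₁ fun ξ₁ =>
    recNorm volume r₂ fun t₂ => recNorm volume r₁ fun t₁ => recNorm volume r₀ fun x =>
      ‖symbSTFT d (gauss3 d) σ x t₁ t₂ ξ₁ ξ₂ ν‖ₑ

/-- The modulation norm in reciprocal exponents, with window `gw b`. -/
def modRecNorm (d : ℕ) (b P Q : ℝ) (f : Ed d → ℂ) : ℝ≥0∞ :=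
  recNorm volume Q fun ν => recNorm volume P fun t => ‖STFT d (gw b) f t ν‖ₑ

lemma measurable_recNorm_STFT (b P : ℝ) {f : Ed d → ℂ} (hf : Measurable f) :
    Measurable fun ν => recNorm volume P fun t => ‖STFT d (gw b) f t ν‖ₑ :=
  measurable_recNorm_prod (F := fun p : Ed d × Ed d => ‖STFT d (gw b) f p.2 p.1‖ₑ) P
    ((measurable_STFT b hf).comp measurable_swap).enorm

lemma modRecNorm_one_le {P Q : ℝ} (hP : 0 ≤ P) (hP1 : P ≤ 1) (hQ : 0 ≤ Q) :
    ∃ C : ℝ≥0∞, C ≠ ∞ ∧ ∀ f : Ed d → ℂ, Measurable f → (∃ M : ℝ, ∀ x, ‖f x‖ ≤ M) →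
      modRecNorm d 1 P Q f ≤ C * modRecNorm d 2 P Q f := by
  refine ⟨ENNReal.ofReal (gaussMass d 4)⁻¹ * recNorm (volume : Measure (Ed d)) (1 + P - P)
    (fun u => ENNReal.ofReal (gs 2 u)), ENNReal.mul_ne_top ENNReal.ofReal_ne_top
    (recNorm_gs_ne_top (by norm_num) (by linarith)), fun f hf ⟨M, hM⟩ => ?_⟩
  rw [modRecNorm, modRecNorm, ← recNorm_const_mul hQ _ (measurable_recNorm_STFT 2 P hf)]
  refine recNorm_mono hQ fun ν => ?_
  rw [mul_assoc]
  exact recNorm_le_of_le_conv hP le_rfl hP1 (F := fun t => ‖STFT d (gw 1) f t ν‖ₑ)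
    (G := fun t => ‖STFT d (gw 2) f t ν‖ₑ)
    ((measurable_STFT 2 hf).comp (measurable_id.prodMk measurable_const)).enorm
    (by fun_prop) (fun t => enorm_STFT_one_le hf hM t ν)

lemma modRecNorm_two_biOp_le {r₀ r₁ r₂ P₀ P₁ P₂ s₁ s₂ s₃ Q₁ Q₂ Q₃ : ℝ}
    (hP₀ : 0 ≤ P₀) (hP₀1 : P₀ ≤ 1) (hQ₃ : 0 ≤ Q₃) (hQ₃1 : Q₃ ≤ 1)
    (hT : TimeEstimate (volume : Measure (Ed d)) r₀ r₁ r₂ P₀ P₁ P₂)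
    (hF : FreqEstimate (volume : Measure (Ed d)) s₁ s₂ s₃ Q₁ Q₂ Q₃)
    {σ : Ed d × Ed d × Ed d → ℂ} (hσ : Measurable σ) {M : ℝ} (hM : ∀ X, ‖σ X‖ ≤ M)
    (f₁ f₂ : SchwartzMap (Ed d) ℂ) :
    ENNReal.ofReal (ptConst d) * modRecNorm d 2 P₀ Q₃ (biOp d σ f₁ f₂) ≤
      (∫⁻ ζ, ‖shiftWeight d ζ‖ₑ) * (symbRecNorm d r₀ r₁ r₂ s₁ s₂ s₃ σ *
        (modRecNorm d 1 P₁ Q₁ f₁ * modRecNorm d 1 P₂ Q₂ f₂)) := by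
  have hb := measurable_biOp hσ (measurable_FT_schwartz f₁) (measurable_FT_schwartz f₂)
  have h := recNorm_recNorm_superposition_le hP₀ hP₀1 hQ₃ hQ₃1 hT hF
    (S := fun q => ‖symbSTFT d (gauss3 d) σ q.1.1 q.1.2.1 q.1.2.2 q.2.1 q.2.2.1 q.2.2.2‖ₑ)
    ((measurable_symbSTFT hσ).comp (f := fun q : (Ed d × Ed d × Ed d) × Ed d × Ed d × Ed d =>
      (q.1.1, q.1.2.1, q.1.2.2, q.2.1, q.2.2.1, q.2.2.2)) (by fun_prop)).enorm
    (A₁ := fun p => ‖STFT d (gw 1) f₁ p.1 p.2‖ₑ) (A₂ := fun p => ‖STFT d (gw 1) f₂ p.1 p.2‖ₑ)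
    (measurable_STFT 1 f₁.continuous.measurable).enorm
    (measurable_STFT 1 f₂.continuous.measurable).enorm
    (ρ := volume) (N := fun ζ => ‖shiftWeight d ζ‖ₑ) measurable_shiftWeight.enorm
    (τ₁ := fun ζ => ζ.1.2) (τ₂ := fun ζ => ζ.2.2) (ν := fun ζ => ζ.1.1 + ζ.2.1)
    (by fun_prop) (by fun_prop) (by fun_prop)
  refine le_trans ?_ h
  rw [modRecNorm, ← recNorm_const_mul hQ₃ _ (measurable_recNorm_STFT 2 P₀ hb)]
  refine recNorm_mono hQ₃ fun ω => ?_
  have m : Measurable fun x => ‖STFT d (gw 2) (biOp d σ f₁ f₂) x ω‖ₑ :=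
    ((measurable_STFT 2 hb).comp (measurable_id.prodMk measurable_const)).enorm
  rw [← recNorm_const_mul hP₀ _ m]
  exact recNorm_mono hP₀ fun x => enorm_STFT_biOp_le hσ hM f₁.integrable f₂.integrable
    (integrable_FT_schwartz f₁) (integrable_FT_schwartz f₂) x ω

lemma exists_modRecNorm_biOp_le {p₀ p₁ p₂ q₁ q₂ q₃ r₀ r₁ r₂ P₀ P₁ P₂ s₁ s₂ s₃ Q₁ Q₂ Q₃ : ℝ}
    (hp₀ : 0 ≤ p₀) (hp₀P : p₀ ≤ P₀) (hP₀1 : P₀ ≤ 1) (hq₃ : 0 ≤ q₃) (hq₃Q : q₃ ≤ Q₃) (hQ₃1 : Q₃ ≤ 1)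
    (hP₁ : 0 ≤ P₁) (hP₁p : P₁ ≤ p₁) (hp₁ : p₁ ≤ 1) (hP₂ : 0 ≤ P₂) (hP₂p : P₂ ≤ p₂) (hp₂ : p₂ ≤ 1)
    (hQ₁ : 0 ≤ Q₁) (hQ₁q : Q₁ ≤ q₁) (hq₁ : q₁ ≤ 1) (hQ₂ : 0 ≤ Q₂) (hQ₂q : Q₂ ≤ q₂) (hq₂ : q₂ ≤ 1)
    (hT : TimeEstimate (volume : Measure (Ed d)) r₀ r₁ r₂ P₀ P₁ P₂)
    (hF : FreqEstimate (volume : Measure (Ed d)) s₁ s₂ s₃ Q₁ Q₂ Q₃) :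
    ∃ C : ℝ≥0∞, C ≠ ∞ ∧ ∀ σ : Ed d × Ed d × Ed d → ℂ, Measurable σ → (∃ M : ℝ, ∀ X, ‖σ X‖ ≤ M) →
      ∀ f₁ f₂ : SchwartzMap (Ed d) ℂ, modRecNorm d 1 p₀ q₃ (biOp d σ f₁ f₂) ≤
        C * symbRecNorm d r₀ r₁ r₂ s₁ s₂ s₃ σ * modRecNorm d 1 p₁ q₁ f₁ *
          modRecNorm d 1 p₂ q₂ f₂ := by
  have hP₀ := hp₀.trans hp₀P
  have hQ₃ := hq₃.trans hq₃Q
  obtain ⟨C₀, hC₀, h₀⟩ := recNorm_recNorm_STFT_le (d := d) hp₀ hp₀P hP₀1 hq₃ hq₃Q hQ₃1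
  obtain ⟨C₁, hC₁, h₁⟩ := recNorm_recNorm_STFT_le (d := d) hP₁ hP₁p hp₁ hQ₁ hQ₁q hq₁
  obtain ⟨C₂, hC₂, h₂⟩ := recNorm_recNorm_STFT_le (d := d) hP₂ hP₂p hp₂ hQ₂ hQ₂q hq₂
  obtain ⟨C₃, hC₃, h₃⟩ := modRecNorm_one_le (d := d) hP₀ hP₀1 hQ₃
  have hc0 : ENNReal.ofReal (ptConst d) ≠ 0 := (ENNReal.ofReal_pos.2 (ptConst_pos d)).ne'
  have hc : (ENNReal.ofReal (ptConst d))⁻¹ ≠ ∞ := ENNReal.inv_ne_top.2 hc0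
  have hN : ∫⁻ ζ, ‖shiftWeight d ζ‖ₑ ≠ ∞ := integrable_shiftWeight.2.ne
  refine ⟨C₀ * C₃ * (ENNReal.ofReal (ptConst d))⁻¹ * (∫⁻ ζ, ‖shiftWeight d ζ‖ₑ) * C₁ * C₂,
    by finiteness, fun σ hσ ⟨M, hM⟩ f₁ f₂ => ?_⟩
  have hb := measurable_biOp hσ (measurable_FT_schwartz f₁) (measurable_FT_schwartz f₂)
  have hbM := exists_norm_biOp_le hM (integrable_FT_schwartz f₁) (integrable_FT_schwartz f₂)
  have h := modRecNorm_two_biOp_le hP₀ hP₀1 hQ₃ hQ₃1 hT hF hσ hM f₁ f₂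
  rw [ENNReal.mul_le_iff_le_inv hc0 ENNReal.ofReal_ne_top] at h
  calc modRecNorm d 1 p₀ q₃ (biOp d σ f₁ f₂)
      ≤ C₀ * (C₃ * modRecNorm d 2 P₀ Q₃ (biOp d σ f₁ f₂)) :=
        (h₀ _ hb hbM).trans (mul_le_mul_right (h₃ _ hb hbM) _)
    _ ≤ C₀ * (C₃ * ((ENNReal.ofReal (ptConst d))⁻¹ * ((∫⁻ ζ, ‖shiftWeight d ζ‖ₑ) *
        (symbRecNorm d r₀ r₁ r₂ s₁ s₂ s₃ σ *
          ((C₁ * modRecNorm d 1 p₁ q₁ f₁) * (C₂ * modRecNorm d 1 p₂ q₂ f₂)))))) := by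
        refine mul_le_mul_right (mul_le_mul_right (h.trans ?_) _) _
        gcongr
        · exact h₁ _ f₁.continuous.measurable (exists_norm_schwartz_le f₁)
        · exact h₂ _ f₂.continuous.measurable (exists_norm_schwartz_le f₂)
    _ = _ := by ring

lemma modNorm_eq {p q : ℝ≥0∞} (hp : 1 ≤ p) (hq : 1 ≤ q) (f : Ed d → ℂ) :
    modNorm d p q f = modRecNorm d 1 (1 / p).toReal (1 / q).toReal f := by
  simp only [modNorm, modRecNorm, eNorm_eq_recNorm _ hp, eNorm_eq_recNorm _ hq, gauss_eq_gw,
    ← enorm_eq_nnnorm]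

lemma symbNorm_eq {r₀ r₁ r₂ s₁ s₂ s₃ : ℝ≥0∞} (hr₀ : 1 ≤ r₀) (hr₁ : 1 ≤ r₁) (hr₂ : 1 ≤ r₂)
    (hs₁ : 1 ≤ s₁) (hs₂ : 1 ≤ s₂) (hs₃ : 1 ≤ s₃) (σ : Ed d × Ed d × Ed d → ℂ) :
    symbNorm d r₀ r₁ r₂ s₁ s₂ s₃ σ = symbRecNorm d (1 / r₀).toReal (1 / r₁).toReal (1 / r₂).toReal
      (1 / s₁).toReal (1 / s₂).toReal (1 / s₃).toReal σ := by
  simp only [symbNorm, symbRecNorm, eNorm_eq_recNorm _ hr₀, eNorm_eq_recNorm _ hr₁,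
    eNorm_eq_recNorm _ hr₂, eNorm_eq_recNorm _ hs₁, eNorm_eq_recNorm _ hs₂, eNorm_eq_recNorm _ hs₃,
    ← enorm_eq_nnnorm]

end Boundedness

section Reciprocals

lemma exists_one_div_eq_coe {p : ℝ≥0∞} (hp : 1 ≤ p) : ∃ x : ℝ≥0, 1 / p = x ∧ x ≤ 1 := by
  have h : 1 / p ≤ 1 := by rwa [one_div, ENNReal.inv_le_one]
  lift 1 / p to ℝ≥0 using (h.trans_lt ENNReal.one_lt_top).ne with x
  exact ⟨x, rfl, by exact_mod_cast h⟩

lemma exists_one_div_conj_eq_coe {x : ℝ≥0} {p : ℝ≥0∞} (h : (x : ℝ≥0∞) + 1 / p = 1) :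
    ∃ y : ℝ≥0, 1 / p = y ∧ (y : ℝ) = 1 - x := by
  have h' : 1 / p ≤ 1 := le_add_self.trans h.le
  lift 1 / p to ℝ≥0 using (h'.trans_lt ENNReal.one_lt_top).ne with y
  have : x + y = 1 := by exact_mod_cast h
  refine ⟨y, rfl, ?_⟩
  rw [← NNReal.coe_one, ← this]
  push_cast
  ring

lemma one_div_max (a b : ℝ≥0∞) : 1 / max a b = min (1 / a) (1 / b) :=
  Antitone.map_max (f := fun x : ℝ≥0∞ => 1 / x) fun _ _ h => ENNReal.div_le_div_left h 1

end Reciprocals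

/-- boundedness of bilinear pseudodifferential operators (the
`κ = (0,1,2)`, `ρ = (1,2,3)` case of Theorem `thm:bilinear` of the paper). -/
theorem stmt10 (d : ℕ) (hd : 1 ≤ d)
    (p₀ p₁ p₂ q₁ q₂ q₃ r₀ r₁ r₂ s₁ s₂ s₃ r₀' q₂' s₁' s₂' : ℝ≥0∞)
    (hp₀ : 1 ≤ p₀) (hp₁ : 1 ≤ p₁) (hp₂ : 1 ≤ p₂)
    (hq₁ : 1 ≤ q₁) (hq₂ : 1 ≤ q₂) (hq₃ : 1 ≤ q₃)
    (hr₀ : 1 ≤ r₀) (hr₁ : 1 ≤ r₁) (hr₂ : 1 ≤ r₂)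
    (hs₁ : 1 ≤ s₁) (hs₂ : 1 ≤ s₂) (hs₃ : 1 ≤ s₃)
    (hc₀ : 1 / r₀ + 1 / r₀' = 1) (hc₁ : 1 / q₂ + 1 / q₂' = 1)
    (hc₂ : 1 / s₁ + 1 / s₁' = 1) (hc₃ : 1 / s₂ + 1 / s₂' = 1)
    (t₁ : 1 ≤ 1 / p₁ + 1 / r₁) (t₂ : 1 ≤ 1 / p₂ + 1 / r₂)
    (t₃ : r₂ ≤ p₀) (t₄ : r₁ ≤ r₀) (t₅ : r₂ ≤ r₀)
    (t₆ : 2 + 1 / p₀ ≤ 1 / r₀ + 1 / r₁ + 1 / r₂ + 1 / max p₁ r₀' + 1 / p₂)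
    (u₁ : s₃ ≤ q₂') (u₂ : s₃ ≤ s₂)
    (u₃ : 2 ≤ 1 / max q₁ s₁' + 1 / max q₂ s₂' + 1 / s₂ + 1 / s₃)
    (u₄ : 2 + 1 / q₃ ≤ 1 / max q₁ s₁' + 1 / max q₂ s₂' + 1 / s₁ + 1 / s₂ + 1 / s₃) :
    ∃ C : ℝ≥0, 0 < C ∧
      ∀ σ : Ed d × Ed d × Ed d → ℂ, Measurable σ → (∃ M : ℝ, ∀ X, ‖σ X‖ ≤ M) →
        symbNorm d r₀ r₁ r₂ s₁ s₂ s₃ σ < ∞ →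
        ∀ f₁ f₂ : SchwartzMap (Ed d) ℂ,
          modNorm d p₀ q₃ (biOp d σ (⇑f₁) (⇑f₂)) ≤
            (C : ℝ≥0∞) * symbNorm d r₀ r₁ r₂ s₁ s₂ s₃ σ *
              modNorm d p₁ q₁ (⇑f₁) * modNorm d p₂ q₂ (⇑f₂) := by
  obtain ⟨xp₀, ep₀, -⟩ := exists_one_div_eq_coe hp₀
  obtain ⟨xp₁, ep₁, lp₁⟩ := exists_one_div_eq_coe hp₁
  obtain ⟨xp₂, ep₂, lp₂⟩ := exists_one_div_eq_coe hp₂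
  obtain ⟨xq₁, eq₁, lq₁⟩ := exists_one_div_eq_coe hq₁
  obtain ⟨xq₂, eq₂, lq₂⟩ := exists_one_div_eq_coe hq₂
  obtain ⟨xq₃, eq₃, lq₃⟩ := exists_one_div_eq_coe hq₃
  obtain ⟨xr₀, er₀, lr₀⟩ := exists_one_div_eq_coe hr₀
  obtain ⟨xr₁, er₁, lr₁⟩ := exists_one_div_eq_coe hr₁
  obtain ⟨xr₂, er₂, lr₂⟩ := exists_one_div_eq_coe hr₂
  obtain ⟨xs₁, es₁, ls₁⟩ := exists_one_div_eq_coe hs₁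
  obtain ⟨xs₂, es₂, ls₂⟩ := exists_one_div_eq_coe hs₂
  obtain ⟨xs₃, es₃, ls₃⟩ := exists_one_div_eq_coe hs₃
  rw [er₀] at hc₀
  rw [eq₂] at hc₁
  rw [es₁] at hc₂
  rw [es₂] at hc₃
  obtain ⟨yr₀, er₀', hyr₀⟩ := exists_one_div_conj_eq_coe hc₀
  obtain ⟨yq₂, eq₂', hyq₂⟩ := exists_one_div_conj_eq_coe hc₁
  obtain ⟨ys₁, es₁', hys₁⟩ := exists_one_div_conj_eq_coe hc₂
  obtain ⟨ys₂, es₂', hys₂⟩ := exists_one_div_conj_eq_coe hc₃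
  replace t₃ := ENNReal.div_le_div_left t₃ 1
  replace t₄ := ENNReal.div_le_div_left t₄ 1
  replace t₅ := ENNReal.div_le_div_left t₅ 1
  replace u₁ := ENNReal.div_le_div_left u₁ 1
  replace u₂ := ENNReal.div_le_div_left u₂ 1
  simp only [one_div_max, ep₀, ep₁, ep₂, eq₁, eq₂, eq₃, er₀, er₁, er₂, es₁, es₂, es₃, er₀', eq₂',
    es₁', es₂'] at t₁ t₂ t₃ t₄ t₅ t₆ u₁ u₂ u₃ u₄
  norm_cast at t₁ t₂ t₃ t₄ t₅ t₆ u₁ u₂ u₃ u₄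
  rw [← NNReal.coe_le_coe] at t₁ t₂ t₃ t₄ t₅ t₆ u₁ u₂ u₃ u₄
  rw [← NNReal.coe_le_coe] at lp₁ lp₂ lq₁ lq₂ lq₃ lr₀ lr₁ lr₂ ls₁ ls₂ ls₃
  push_cast [hyr₀, hyq₂, hys₁, hys₂] at t₁ t₂ t₃ t₄ t₅ t₆ u₁ u₂ u₃ u₄
  push_cast at lp₁ lp₂ lq₁ lq₂ lq₃ lr₀ lr₁ lr₂ ls₁ ls₂ ls₃
  obtain ⟨P₀, P₁, P₂, hP₀, hP₀1, hP₁, hP₁p, hP₂, hP₂p, hT⟩ := exists_timeEstimate (d := d)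
    xp₀.coe_nonneg xr₀.coe_nonneg lr₀ lr₁ lr₂ t₁ t₂ t₃ t₄ t₅ t₆
  obtain ⟨Q₁, Q₂, Q₃, hQ₃, hQ₃1, hQ₁, hQ₁q, hQ₂, hQ₂q, hF⟩ := exists_freqEstimate (d := d)
    xq₃.coe_nonneg lq₃ xs₁.coe_nonneg ls₁ xs₂.coe_nonneg ls₂ ls₃ u₁ u₂ u₃ u₄
  obtain ⟨C, hC, h⟩ := exists_modRecNorm_biOp_le xp₀.coe_nonneg hP₀ hP₀1 xq₃.coe_nonneg hQ₃ hQ₃1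
    hP₁ hP₁p lp₁ hP₂ hP₂p lp₂ hQ₁ hQ₁q lq₁ hQ₂ hQ₂q lq₂ hT hF
  refine ⟨C.toNNReal + 1, by positivity, fun σ hσ hM _ f₁ f₂ => ?_⟩
  have hC' : C ≤ ((C.toNNReal + 1 : ℝ≥0) : ℝ≥0∞) := by
    rw [ENNReal.coe_add, ENNReal.coe_toNNReal hC]
    exact le_self_add
  rw [modNorm_eq hp₀ hq₃, modNorm_eq hp₁ hq₁, modNorm_eq hp₂ hq₂,
    symbNorm_eq hr₀ hr₁ hr₂ hs₁ hs₂ hs₃, ep₀, ep₁, ep₂, eq₁, eq₂, eq₃, er₀, er₁, er₂, es₁, es₂, es₃]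
  simp only [ENNReal.coe_toReal]
  refine (h σ hσ hM f₁ f₂).trans ?_
  gcongr

end
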